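/- Let T > 0 and ξ₁⁰ < ξ₂⁰ be real constants. Let u be a classical solution of the linear parabolic equation u_t = a(x,t) u_xx + b(x,t) u_x + c(x,t) u on Ω = (ξ₁⁰, ξ₂⁰) × (0,T], where the coefficients satisfy the regularity assumption (1.2). Assume that for each i ∈ {1,2}, either u(ξᵢ⁰,t) = 0 for all t ∈ [0,T] or u(ξᵢ⁰,t) ≠ 0 for all t ∈ [0,T]. Then the number Z(t) of zeros of u(·,t) in [ξ₁⁰, ξ₂⁰] is non-increasing in t on (0,T): if 0 < t₁ ≤ t₂ < T then Z(t₁) ≥ Z(t₂). -/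

import Mathlib

open Set

/-- spatial partial derivative `u_x` -/
noncomputable def pdx (u : ℝ → ℝ → ℝ) (x t : ℝ) : ℝ := deriv (fun y => u y t) x

/-- second spatial partial derivative `u_xx` -/
noncomputable def pdxx (u : ℝ → ℝ → ℝ) (x t : ℝ) : ℝ := deriv (fun y => pdx u y t) x

/-- time partial derivative `u_t` -/
noncomputable def pdt (u : ℝ → ℝ → ℝ) (x t : ℝ) : ℝ := deriv (fun s => u x s) t

/-- the closure of the space-time domain `Ω` -/
def domCl (xi1 xi2 : ℝ → ℝ) (T : ℝ) : Set (ℝ × ℝ) :=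
  {p : ℝ × ℝ | p.2 ∈ Icc (0:ℝ) T ∧ p.1 ∈ Icc (xi1 p.2) (xi2 p.2)}

/-- the domain together with its lateral boundaries -/
def domLat (xi1 xi2 : ℝ → ℝ) (T : ℝ) : Set (ℝ × ℝ) :=
  {p : ℝ × ℝ | p.2 ∈ Ioc (0:ℝ) T ∧ p.1 ∈ Icc (xi1 p.2) (xi2 p.2)}

/-- `u` is a classical solution of `u_t = a u_xx + b u_x + c u` on
`Ω = {(x,t) : ξ₁(t) < x < ξ₂(t), 0 < t ≤ T}`: it is continuous on the closure, its
partial derivatives `u_t, u_x, u_xx` exist and are continuous up to the lateral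
boundaries, and the equation holds. -/
structure IsClassicalSolution (a b c : ℝ → ℝ → ℝ) (xi1 xi2 : ℝ → ℝ) (T : ℝ)
    (u : ℝ → ℝ → ℝ) : Prop where
  cont : ContinuousOn (fun p : ℝ × ℝ => u p.1 p.2) (domCl xi1 xi2 T)
  diff_x : ∀ p ∈ domLat xi1 xi2 T, DifferentiableAt ℝ (fun y => u y p.2) p.1
  diff_xx : ∀ p ∈ domLat xi1 xi2 T, DifferentiableAt ℝ (fun y => pdx u y p.2) p.1
  diff_t : ∀ p ∈ domLat xi1 xi2 T, DifferentiableAt ℝ (fun s => u p.1 s) p.2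
  cont_x : ContinuousOn (fun p : ℝ × ℝ => pdx u p.1 p.2) (domLat xi1 xi2 T)
  cont_xx : ContinuousOn (fun p : ℝ × ℝ => pdxx u p.1 p.2) (domLat xi1 xi2 T)
  cont_t : ContinuousOn (fun p : ℝ × ℝ => pdt u p.1 p.2) (domLat xi1 xi2 T)
  eqn : ∀ p ∈ domLat xi1 xi2 T,
    pdt u p.1 p.2 =
      a p.1 p.2 * pdxx u p.1 p.2 + b p.1 p.2 * pdx u p.1 p.2 + c p.1 p.2 * u p.1 p.2

/-- the regularity assumption (1.2): `a, a⁻¹, a_t, a_x, a_xx, b, b_t, b_x, c ∈ L^∞`,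
with `a > 0` -/
def Reg12 (a b c : ℝ → ℝ → ℝ) (xi1 xi2 : ℝ → ℝ) (T : ℝ) : Prop :=
  ∃ M : ℝ, ∀ p ∈ domLat xi1 xi2 T,
    0 < a p.1 p.2 ∧
    DifferentiableAt ℝ (fun y => a y p.2) p.1 ∧
    DifferentiableAt ℝ (fun y => pdx a y p.2) p.1 ∧
    DifferentiableAt ℝ (fun s => a p.1 s) p.2 ∧
    DifferentiableAt ℝ (fun y => b y p.2) p.1 ∧
    DifferentiableAt ℝ (fun s => b p.1 s) p.2 ∧
    |a p.1 p.2| ≤ M ∧ |(a p.1 p.2)⁻¹| ≤ M ∧ |pdt a p.1 p.2| ≤ M ∧ |pdx a p.1 p.2| ≤ M ∧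
    |pdxx a p.1 p.2| ≤ M ∧ |b p.1 p.2| ≤ M ∧ |pdt b p.1 p.2| ≤ M ∧ |pdx b p.1 p.2| ≤ M ∧
    |c p.1 p.2| ≤ M

/-- the set of zeroes of `u(·,t)` in `I(t) = [ξ₁(t), ξ₂(t)]` -/
def zeroSet (u : ℝ → ℝ → ℝ) (xi1 xi2 : ℝ → ℝ) (t : ℝ) : Set ℝ :=
  {x ∈ Icc (xi1 t) (xi2 t) | u x t = 0}

/-- `Z(t)`: the (extended-natural) number of zeroes of `u(·,t)` in `I(t)` -/
noncomputable def Znum (u : ℝ → ℝ → ℝ) (xi1 xi2 : ℝ → ℝ) (t : ℝ) : ℕ∞ :=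
  (zeroSet u xi1 xi2 t).encard

/-- `u(·,s)` has a multiple (degenerate) zero in `I(s)` -/
def HasMultipleZero (u : ℝ → ℝ → ℝ) (xi1 xi2 : ℝ → ℝ) (s : ℝ) : Prop :=
  ∃ x₀ ∈ Icc (xi1 s) (xi2 s), u x₀ s = 0 ∧ pdx u x₀ s = 0

section Helpers
open Set Filter Topology


theorem second_deriv_nonpos {f v : ℝ → ℝ} {x k : ℝ} (h : IsLocalMax f x)
    (hf : ∀ᶠ y in 𝓝 x, HasDerivAt f (v y) y) (hv : HasDerivAt v k x) : v x = 0 ∧ k ≤ 0 := by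
  have h0 : v x = 0 := h.hasDerivAt_eq_zero hf.self_of_nhds
  refine ⟨h0, ?_⟩
  by_contra hk
  push Not at hk
  have hd : deriv f =ᶠ[𝓝 x] v := hf.mono fun y hy => hy.deriv
  have h2 : deriv (deriv f) x = k := by rw [hd.deriv_eq]; exact hv.deriv
  have hmin : IsLocalMin f x := isLocalMin_of_deriv_deriv_pos (by rw [h2]; exact hk)
    (by rw [hd.self_of_nhds, h0]) hf.self_of_nhds.continuousAt
  have hc : f =ᶠ[𝓝 x] fun _ => f x := by
    filter_upwards [h, hmin] with y h1 h2
    exact le_antisymm h1 h2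
  have : deriv (deriv f) x = 0 := by
    have h3 : deriv f =ᶠ[𝓝 x] fun _ => 0 := by
      have := hc.deriv
      simpa using this
    rw [h3.deriv_eq]; simp
  linarith

theorem alt_lemma (m : ℕ) (w : ℝ → ℝ → ℝ) (lam : ℝ → ℝ) (X1 X2 s0 t0 : ℝ) (hs : s0 ≤ t0)
    (hw : ContinuousOn (fun p : ℝ × ℝ => w p.1 p.2) (Icc X1 X2 ×ˢ Icc s0 t0))
    (hl : Continuous lam) (hpos : ∀ τ, 0 < lam τ)
    (hlat : ∀ X, X = X1 ∨ X = X2 → ∀ i : Fin (m+1), ∀ τ ∈ Icc s0 t0,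
      lam τ ≤ (-1)^(i:ℕ) * w X τ → ∀ τ' ∈ Icc s0 τ, lam τ' ≤ (-1)^(i:ℕ) * w X τ')
    (hint : ∀ i : Fin (m+1), ∀ x ∈ Ioo X1 X2, ∀ τ ∈ Ioc s0 t0,
      IsLocalMax (fun y => (-1)^(i:ℕ) * w y τ) x → (-1)^(i:ℕ) * w x τ = lam τ →
      ∃ d, HasDerivAt (fun τ => (-1)^(i:ℕ) * w x τ - lam τ) d τ ∧ d < 0)
    (h1 : ∃ y : Fin (m+1) → ℝ, Monotone y ∧ ∀ i, y i ∈ Icc X1 X2 ∧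
      lam t0 ≤ (-1)^(i:ℕ) * w (y i) t0) :
    ∃ y : Fin (m+1) → ℝ, Monotone y ∧ ∀ i, y i ∈ Icc X1 X2 ∧
      lam s0 ≤ (-1)^(i:ℕ) * w (y i) s0 := by
  set A : ℝ → (Fin (m+1) → ℝ) → Prop := fun τ y => Monotone y ∧ ∀ i, y i ∈ Icc X1 X2 ∧
      lam τ ≤ (-1)^(i:ℕ) * w (y i) τ with hA
  set C : Set (ℝ × (Fin (m+1) → ℝ)) := Icc s0 t0 ×ˢ (Set.pi univ fun _ => Icc X1 X2) with hC
  have hCc : IsCompact C := isCompact_Icc.prod (isCompact_univ_pi fun _ => isCompact_Icc)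
  have hcont : ∀ i : Fin (m+1), ContinuousOn
      (fun p : ℝ × (Fin (m+1) → ℝ) => (-1)^(i:ℕ) * w (p.2 i) p.1 - lam p.1) C := by
    intro i
    have h2 : ContinuousOn (fun p : ℝ × (Fin (m+1) → ℝ) => w (p.2 i) p.1) C := by
      refine hw.comp (f := fun p : ℝ × (Fin (m+1) → ℝ) => (p.2 i, p.1)) (by fun_prop) ?_
      rintro p ⟨hp1, hp2⟩
      exact ⟨hp2 i trivial, hp1⟩
    exact (h2.const_mul _).sub (hl.comp continuous_fst).continuousOn
  set G : Set (ℝ × (Fin (m+1) → ℝ)) := {p | p.1 ∈ Icc s0 t0 ∧ A p.1 p.2} with hG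
  have hGeq : G = C ∩ ((⋂ i : Fin (m+1), C ∩ (fun p : ℝ × (Fin (m+1) → ℝ) =>
      (-1)^(i:ℕ) * w (p.2 i) p.1 - lam p.1) ⁻¹' Ici 0) ∩ {p | Monotone p.2}) := by
    ext p
    simp only [hG, hA, hC, mem_ofPred_eq, mem_inter_iff, mem_iInter, mem_preimage, mem_Ici,
      Set.mem_prod, Set.mem_pi, mem_univ, forall_true_left, sub_nonneg]
    constructor
    · rintro ⟨a, b, c⟩
      exact ⟨⟨a, fun i => (c i).1⟩, fun i => ⟨⟨a, fun i => (c i).1⟩, (c i).2⟩, b⟩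
    · rintro ⟨⟨a, b⟩, c, d⟩
      exact ⟨a, d, fun i => ⟨b i, (c i).2⟩⟩
  have hGc : IsCompact G := by
    rw [hGeq]
    apply hCc.inter_right
    apply IsClosed.inter
    · apply isClosed_iInter
      intro i
      exact (hcont i).preimage_isClosed_of_isClosed hCc.isClosed isClosed_Ici
    · exact isClosed_monotone.preimage continuous_snd
  set S := Prod.fst '' G with hS
  have hSc : IsCompact S := hGc.image continuous_fst
  obtain ⟨y1, hy1⟩ := h1
  have hSn : S.Nonempty := ⟨t0, (t0, y1), ⟨right_mem_Icc.2 hs, hy1⟩, rfl⟩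
  obtain ⟨⟨τ, y0⟩, ⟨hτ, hy0⟩, hτe⟩ := hSc.sInf_mem hSn
  simp only at hτ hy0 hτe
  rcases eq_or_lt_of_le hτ.1 with h | hlt
  · rw [h]; exact ⟨y0, hy0⟩
  exfalso
  -- maximise
  have hKc : IsCompact {y | A τ y} := by
    have : {y | A τ y} = Prod.snd '' (G ∩ (Prod.fst ⁻¹' {τ})) := by
      ext y
      constructor
      · intro hy; exact ⟨(τ, y), ⟨⟨hτ, hy⟩, rfl⟩, rfl⟩
      · rintro ⟨⟨a, b⟩, ⟨⟨_, h2⟩, h3⟩, rfl⟩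
        simp only [mem_preimage, mem_singleton_iff] at h3
        simp only at h2
        rw [h3] at h2; exact h2
    rw [this]
    exact (hGc.inter_right (isClosed_singleton.preimage continuous_fst)).image continuous_snd
  have hΦ : ContinuousOn (fun y : Fin (m+1) → ℝ => ∑ i : Fin (m+1), (-1)^(i:ℕ) * w (y i) τ) {y | A τ y} := by
    apply continuousOn_finsetSum
    intro i _
    have h2 : ContinuousOn (fun y : (Fin (m+1) → ℝ) => w (y i) τ) {y | A τ y} := by
      refine hw.comp (f := fun p : (Fin (m+1) → ℝ) => (p i, τ)) (by fun_prop) ?_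
      intro p hp
      exact ⟨(hp.2 i).1, hτ⟩
    exact h2.const_mul _
  obtain ⟨y, hy, hmax⟩ := hKc.exists_isMaxOn ⟨y0, hy0⟩ hΦ
  have hymem := hy.2
  have hstrict : StrictMono y := by
    rw [Fin.strictMono_iff_lt_succ]
    intro i
    refine lt_of_le_of_ne (hy.1 (Fin.castSucc_lt_succ).le) ?_
    intro he
    have ha := (hymem i.castSucc).2
    have hb := (hymem i.succ).2
    rw [← he] at hb
    simp only [Fin.val_castSucc, Fin.val_succ, pow_succ] at ha hb
    have := hpos τ
    linarith
  have key : ∀ i : Fin (m+1), ∀ᶠ τ' in 𝓝[<] τ, lam τ' ≤ (-1)^(i:ℕ) * w (y i) τ' := by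
    intro i
    have hIoo : Ioo s0 τ ∈ 𝓝[<] τ := Ioo_mem_nhdsLT hlt
    by_cases hb : y i = X1 ∨ y i = X2
    · filter_upwards [hIoo] with τ' h'
      exact hlat (y i) hb i τ hτ (hymem i).2 τ' ⟨h'.1.le, h'.2.le⟩
    push Not at hb
    have hyi : y i ∈ Ioo X1 X2 := ⟨lt_of_le_of_ne (hymem i).1.1 (Ne.symm hb.1),
      lt_of_le_of_ne (hymem i).1.2 hb.2⟩
    rcases eq_or_lt_of_le (hymem i).2 with he | hgt
    · have hloc : IsLocalMax (fun z => (-1)^(i:ℕ) * w z τ) (y i) := by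
        have hev1 : ∀ᶠ z in 𝓝 (y i), z ∈ Ioo X1 X2 := Ioo_mem_nhds hyi.1 hyi.2
        have hev2 : ∀ᶠ z in 𝓝 (y i), ∀ j : Fin (m+1), j < i → y j < z :=
          eventually_all.2 fun j => by
            by_cases hj : j < i
            · filter_upwards [lt_mem_nhds (hstrict hj)] with z hz _ using hz
            · exact Eventually.of_forall fun z h => absurd h hj
        have hev3 : ∀ᶠ z in 𝓝 (y i), ∀ j : Fin (m+1), i < j → z < y j :=
          eventually_all.2 fun j => by
            by_cases hj : i < j
            · filter_upwards [gt_mem_nhds (hstrict hj)] with z hz _ using hz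
            · exact Eventually.of_forall fun z h => absurd h hj
        filter_upwards [hev1, hev2, hev3] with z hz1 hz2 hz3
        by_contra hcon
        push Not at hcon
        have hA' : A τ (Function.update y i z) := by
          refine ⟨?_, ?_⟩
          · intro j k hjk
            by_cases h1 : j = i
            · by_cases h2 : k = i
              · rw [h1, h2]
              · rw [h1, Function.update_self, Function.update_of_ne h2]
                rw [h1] at hjk
                exact (hz3 k (lt_of_le_of_ne hjk (Ne.symm h2))).le
            · by_cases h2 : k = i
              · rw [h2, Function.update_self, Function.update_of_ne h1]
                rw [h2] at hjk
                exact (hz2 j (lt_of_le_of_ne hjk h1)).le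
              · rw [Function.update_of_ne h1, Function.update_of_ne h2]
                exact hy.1 hjk
          · intro j
            by_cases h1 : j = i
            · rw [h1, Function.update_self]
              exact ⟨⟨hz1.1.le, hz1.2.le⟩, by linarith⟩
            · rw [Function.update_of_ne h1]
              exact hymem j
        have := hmax hA'
        simp only [mem_ofPred_eq] at this
        have h3 : ∑ j : Fin (m+1), (-1)^(j:ℕ) * w (y j) τ <
            ∑ j : Fin (m+1), (-1)^(j:ℕ) * w ((Function.update y i z) j) τ := by
          apply Finset.sum_lt_sum
          · intro j _
            by_cases h1 : j = i
            · rw [h1, Function.update_self]; exact hcon.le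
            · rw [Function.update_of_ne h1]
          · exact ⟨i, Finset.mem_univ _, by rw [Function.update_self]; exact hcon⟩
        linarith
      obtain ⟨d, hd, hd0⟩ := hint i (y i) hyi τ ⟨hlt, hτ.2⟩ hloc he.symm
      have hsl := (hasDerivAt_iff_tendsto_slope_left_right.1 hd).1
      have := hsl.eventually (gt_mem_nhds hd0)
      filter_upwards [this, self_mem_nhdsWithin] with τ' h' h''
      rw [slope_def_field] at h'
      rw [he] at h'
      simp only [mem_Iio] at h''
      have h4 : τ' - τ < 0 := by linarith
      rw [div_neg_iff] at h'
      rcases h' with h' | h' <;> linarith [h'.1, h'.2]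
    · have hct : ContinuousWithinAt (fun τ' => (-1)^(i:ℕ) * w (y i) τ' - lam τ') (Icc s0 t0) τ := by
        have h2 : ContinuousOn (fun τ' => w (y i) τ') (Icc s0 t0) := by
          refine hw.comp (f := fun τ' => (y i, τ')) (by fun_prop) ?_
          intro p hp
          exact ⟨(hymem i).1, hp⟩
        exact ((h2.const_mul _).sub hl.continuousOn) τ hτ
      have h5 : ∀ᶠ τ' in 𝓝[Icc s0 t0] τ, 0 < (-1)^(i:ℕ) * w (y i) τ' - lam τ' :=
        hct.eventually (lt_mem_nhds (by simpa using hgt))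
      have h6 : 𝓝[<] τ ≤ 𝓝[Icc s0 t0] τ := by
        apply nhdsWithin_le_of_mem
        filter_upwards [hIoo] with z hz
        exact ⟨hz.1.le, hz.2.le.trans hτ.2⟩
      filter_upwards [h6 h5] with z hz
      linarith
  have hall := eventually_all.2 key
  obtain ⟨τ', h1, h2⟩ := (hall.and (Ioo_mem_nhdsLT hlt)).exists
  have hmem : τ' ∈ S := ⟨(τ', y), ⟨⟨h2.1.le, h2.2.le.trans hτ.2⟩, hy.1, fun i => ⟨(hymem i).1, h1 i⟩⟩, rfl⟩
  have := csInf_le hSc.bddBelow hmem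
  rw [← hτe] at this
  linarith [h2.2]


/-- local parabolic solution on a rectangle -/
def PS (u : ℝ → ℝ → ℝ) (κ M X1 X2 s0 t0 : ℝ) : Prop :=
  ContinuousOn (fun p : ℝ × ℝ => u p.1 p.2) (Icc X1 X2 ×ˢ Icc s0 t0) ∧
  ∀ x ∈ Ioo X1 X2, ∀ τ ∈ Icc s0 t0, ∃ (ut k a b c : ℝ) (v : ℝ → ℝ),
    HasDerivAt (u x) ut τ ∧ (∀ᶠ y in 𝓝 x, HasDerivAt (fun y => u y τ) (v y) y) ∧
    HasDerivAt v k x ∧ ut = a * k + b * v x + c * u x τ ∧ κ ≤ a ∧ a ≤ M ∧ |b| ≤ M ∧ |c| ≤ M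

theorem PS.smul {u : ℝ → ℝ → ℝ} {κ M X1 X2 s0 t0 : ℝ} (h : PS u κ M X1 X2 s0 t0) (e : ℝ) :
    PS (fun x t => e * u x t) κ M X1 X2 s0 t0 := by
  refine ⟨h.1.const_mul e, ?_⟩
  intro x hx τ hτ
  obtain ⟨ut, k, a, b, c, v, h1, h2, h3, h4, h5⟩ := h.2 x hx τ hτ
  refine ⟨e * ut, e * k, a, b, c, fun y => e * v y, h1.const_mul e, ?_, h3.const_mul e, ?_, h5⟩
  · filter_upwards [h2] with y hy using hy.const_mul e
  · rw [h4]; ring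

theorem PS.neg {u : ℝ → ℝ → ℝ} {κ M X1 X2 s0 t0 : ℝ} (h : PS u κ M X1 X2 s0 t0) :
    PS (fun x t => - u x t) κ M X1 X2 s0 t0 := by
  have := h.smul (-1)
  simpa using this

theorem PS.mono {u : ℝ → ℝ → ℝ} {κ M X1 X2 s0 t0 Y1 Y2 s1 t1 : ℝ} (h : PS u κ M X1 X2 s0 t0)
    (h1 : X1 ≤ Y1) (h2 : Y2 ≤ X2) (h3 : s0 ≤ s1) (h4 : t1 ≤ t0) : PS u κ M Y1 Y2 s1 t1 := by
  refine ⟨h.1.mono (Set.prod_mono (Icc_subset_Icc h1 h2) (Icc_subset_Icc h3 h4)), ?_⟩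
  intro x hx τ hτ
  exact h.2 x ⟨h1.trans_lt hx.1, hx.2.trans_le h2⟩ τ ⟨h3.trans hτ.1, hτ.2.trans h4⟩

theorem PS.cont_t {u : ℝ → ℝ → ℝ} {κ M X1 X2 s0 t0 : ℝ} (h : PS u κ M X1 X2 s0 t0) {x : ℝ}
    (hx : x ∈ Icc X1 X2) : ContinuousOn (u x) (Icc s0 t0) := by
  refine h.1.comp (f := fun τ' => (x, τ')) (by fun_prop) ?_
  intro p hp
  exact ⟨hx, hp⟩

theorem PS.cont_x {u : ℝ → ℝ → ℝ} {κ M X1 X2 s0 t0 : ℝ} (h : PS u κ M X1 X2 s0 t0) {τ : ℝ}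
    (hx : τ ∈ Icc s0 t0) : ContinuousOn (fun x => u x τ) (Icc X1 X2) := by
  refine h.1.comp (f := fun x => (x, τ)) (by fun_prop) ?_
  intro p hp
  exact ⟨hp, hx⟩

theorem PS.localMax {u : ℝ → ℝ → ℝ} {κ M X1 X2 s0 t0 : ℝ} (h : PS u κ M X1 X2 s0 t0)
    (hκ : 0 ≤ κ) {x τ : ℝ} (hx : x ∈ Ioo X1 X2) (hτ : τ ∈ Icc s0 t0) {g g1 : ℝ → ℝ} {g2 : ℝ}
    (hg : ∀ y, HasDerivAt g (g1 y) y) (hg1 : HasDerivAt g1 g2 x)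
    (hm : IsLocalMax (fun y => u y τ + g y) x) :
    ∃ ut a b c, HasDerivAt (u x) ut τ ∧ κ ≤ a ∧ a ≤ M ∧ |b| ≤ M ∧ |c| ≤ M ∧
      ut ≤ - a * g2 - b * g1 x + c * u x τ := by
  obtain ⟨ut, k, a, b, c, v, h1, h2, h3, h4, h5, h6, h7, h8⟩ := h.2 x hx τ hτ
  refine ⟨ut, a, b, c, h1, h5, h6, h7, h8, ?_⟩
  have := second_deriv_nonpos (v := fun y => v y + g1 y) hm
    (h2.mono fun y hy => hy.add (hg y)) (h3.add hg1)
  obtain ⟨e1, e2⟩ := this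
  have e3 : v x = - g1 x := by linarith
  rw [h4, e3]
  have : a * (k + g2) ≤ 0 := mul_nonpos_of_nonneg_of_nonpos (by linarith) e2
  nlinarith

theorem PS.cmp {u : ℝ → ℝ → ℝ} {κ M X1 X2 s0 t0 : ℝ} (h : PS u κ M X1 X2 s0 t0)
    (hκ : 0 ≤ κ) (g gt gx gxx : ℝ → ℝ → ℝ)
    (hgc : Continuous (fun p : ℝ × ℝ => g p.1 p.2))
    (hgt : ∀ x τ, HasDerivAt (g x) (gt x τ) τ)
    (hgx : ∀ x τ, HasDerivAt (fun y => g y τ) (gx x τ) x)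
    (hgxx : ∀ x τ, HasDerivAt (fun y => gx y τ) (gxx x τ) x)
    (hsub : ∀ x ∈ Ioo X1 X2, ∀ τ ∈ Icc s0 t0, u x τ < g x τ → ∀ a b c, κ ≤ a → |b| ≤ M → |c| ≤ M →
      gt x τ ≤ a * gxx x τ + b * gx x τ + c * g x τ)
    (hbot : ∀ x ∈ Icc X1 X2, g x s0 ≤ u x s0)
    (hl1 : ∀ τ ∈ Icc s0 t0, g X1 τ ≤ u X1 τ) (hl2 : ∀ τ ∈ Icc s0 t0, g X2 τ ≤ u X2 τ) :
    ∀ x ∈ Icc X1 X2, ∀ τ ∈ Icc s0 t0, g x τ ≤ u x τ := by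
  intro x hx t ht
  by_contra hcon
  push Not at hcon
  set L := g x t - u x t with hL
  have hLp : 0 < L := by rw [hL]; linarith
  have h' : PS u κ M X1 X2 s0 t := h.mono le_rfl le_rfl le_rfl ht.2
  have hlamd : ∀ τ, HasDerivAt (fun τ => L * Real.exp ((M+1)*(τ - t)))
      (L * (Real.exp ((M+1)*(τ - t)) * (M+1))) τ := by
    intro τ
    have h0 : HasDerivAt (fun τ => (M+1)*(τ - t)) (M+1) τ := by
      simpa using ((hasDerivAt_id τ).sub_const t).const_mul (M+1)
    exact h0.exp.const_mul L
  have := alt_lemma 0 (fun x τ => g x τ - u x τ) (fun τ => L * Real.exp ((M+1)*(τ - t)))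
    X1 X2 s0 t ht.1 (hgc.continuousOn.sub h'.1) (by fun_prop) (fun τ => by positivity)
    ?_ ?_ ?_
  · obtain ⟨y, -, hy⟩ := this
    have h1 := hy 0
    have h2 := hbot (y 0) h1.1
    have h3 : 0 < L * Real.exp ((M+1)*(s0 - t)) := by positivity
    have h4 := h1.2
    simp at h4
    linarith
  · intro X hX i τ hτ hle
    exfalso
    have h3 : 0 < L * Real.exp ((M+1)*(τ - t)) := by positivity
    have h4 : (i:ℕ) = 0 := by omega
    rw [h4] at hle
    have hτ' : τ ∈ Icc s0 t0 := ⟨hτ.1, hτ.2.trans ht.2⟩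
    rcases hX with rfl | rfl
    · have := hl1 τ hτ'; simp at hle; linarith
    · have := hl2 τ hτ'; simp at hle; linarith
  · intro i x' hx' τ hτ hmax heq
    have h4 : (i:ℕ) = 0 := by omega
    rw [h4] at hmax heq
    simp only [pow_zero, one_mul] at hmax heq
    have hτ' : τ ∈ Icc s0 t := ⟨hτ.1.le, hτ.2⟩
    have hm : IsLocalMax (fun y => (- u y τ) + g y τ) x' := by
      have : (fun y => (- u y τ) + g y τ) = fun y => g y τ - u y τ := by
        ext y; ring
      rw [this]; exact hmax
    obtain ⟨ut, a, b, c, e1, e2, e3, e4, e5, e6⟩ := h'.neg.localMax hκ hx' hτ'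
      (fun y => hgx y τ) (hgxx x' τ) hm
    have hpos : 0 < L * Real.exp ((M+1)*(τ - t)) := by positivity
    have hs := hsub x' hx' τ ⟨hτ'.1, hτ.2.trans ht.2⟩ (by linarith) a b c e2 e4 e5
    refine ⟨gt x' τ + ut - L * (Real.exp ((M+1)*(τ-t)) * (M+1)), ?_, ?_⟩
    · rw [h4]
      simp only [pow_zero, one_mul]
      have := ((hgt x' τ).add e1).sub (hlamd τ)
      refine this.congr_of_eventuallyEq (Eventually.of_forall fun z => ?_)
      simp [sub_eq_add_neg]
    · have e7 : c * (g x' τ - u x' τ) ≤ M * (g x' τ - u x' τ) :=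
        mul_le_mul_of_nonneg_right (le_abs_self c |>.trans e5) (by linarith)
      rw [heq] at e7
      have e8 : c * (- u x' τ) = c * (g x' τ - u x' τ) - c * g x' τ := by ring
      rw [heq] at e8
      nlinarith
  · refine ⟨fun _ => x, monotone_const, fun i => ⟨hx, ?_⟩⟩
    have h4 : (i:ℕ) = 0 := by omega
    rw [h4]; simp [hL]

theorem PS.nonneg {u : ℝ → ℝ → ℝ} {κ M X1 X2 s0 t0 : ℝ} (h : PS u κ M X1 X2 s0 t0)
    (hκ : 0 ≤ κ)
    (hbot : ∀ x ∈ Icc X1 X2, 0 ≤ u x s0)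
    (hl1 : ∀ τ ∈ Icc s0 t0, 0 ≤ u X1 τ) (hl2 : ∀ τ ∈ Icc s0 t0, 0 ≤ u X2 τ) :
    ∀ x ∈ Icc X1 X2, ∀ τ ∈ Icc s0 t0, 0 ≤ u x τ := by
  refine h.cmp hκ (fun _ _ => 0) (fun _ _ => 0) (fun _ _ => 0) (fun _ _ => 0) continuous_const
    (fun x τ => hasDerivAt_const _ _) (fun x τ => hasDerivAt_const _ _)
    (fun x τ => hasDerivAt_const _ _) ?_ hbot hl1 hl2
  intros; simp

/-- strong maximum principle -/
theorem PS.pos {u : ℝ → ℝ → ℝ} {κ M X1 X2 s0 t0 : ℝ} (h : PS u κ M X1 X2 s0 t0)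
    (hκ : 0 < κ) (hM : 0 ≤ M) (hst : s0 < t0)
    (hbot : ∀ x ∈ Icc X1 X2, 0 ≤ u x s0)
    (hl1 : ∀ τ ∈ Icc s0 t0, 0 ≤ u X1 τ) (hl2 : ∀ τ ∈ Icc s0 t0, 0 ≤ u X2 τ)
    (hor : (∀ τ ∈ Icc s0 t0, 0 < u X1 τ) ∨ (∀ τ ∈ Icc s0 t0, 0 < u X2 τ)) :
    ∀ x ∈ Ioo X1 X2, ∀ τ ∈ Ioc s0 t0, 0 < u x τ := by
  intro x hx t ht
  have hnn := h.nonneg hκ.le hbot hl1 hl2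
  have hXX : X1 < X2 := hx.1.trans hx.2
  -- reduce to direction d and base point x0
  obtain ⟨d, x0, x1, hd, hx0, hx1, hdx, hdb, hd01, hp⟩ : ∃ d x0 x1 : ℝ, (d = 1 ∨ d = -1) ∧
      (x0 = X1 ∨ x0 = X2) ∧ (x1 = X1 ∨ x1 = X2) ∧ 0 < d * (x - x0) ∧
      (∀ y ∈ Icc X1 X2, d * (y - x0) ≤ X2 - X1) ∧ (∀ X, X = X1 ∨ X = X2 → X = x0 ∨ X = x1) ∧
      ∀ τ ∈ Icc s0 t0, 0 < u x1 τ := by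
    rcases hor with hp | hp
    · exact ⟨-1, X2, X1, by simp, by simp, by simp, by linarith [hx.2],
        fun y hy => by linarith [hy.1], by tauto, hp⟩
    · exact ⟨1, X1, X2, by simp, by simp, by simp, by linarith [hx.1],
        fun y hy => by linarith [hy.2], by tauto, hp⟩
  have hdd : d * d = 1 := by rcases hd with rfl | rfl <;> norm_num
  have hdabs : |d| = 1 := by rcases hd with rfl | rfl <;> norm_num
  set ℓ := (X2 - X1) / (t - s0) with hℓ
  have hts : 0 < t - s0 := by linarith [ht.1]
  have hℓp : 0 < ℓ := div_pos (by linarith) hts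
  obtain ⟨μ, hμ1, hμ⟩ : ∃ μ : ℝ, 1 ≤ μ ∧ μ * ℓ + M * μ + M ≤ κ * μ^2 := by
    refine ⟨1 + (ℓ + 2 * M) / κ, by have : 0 ≤ (ℓ + 2*M)/κ := by positivity
                                    linarith, ?_⟩
    set q := (ℓ + 2 * M) / κ with hq
    have hq0 : 0 ≤ q := by positivity
    have hqk : κ * q = ℓ + 2 * M := by rw [hq]; field_simp
    have e : κ * (1+q)^2 = κ * (1 + q) + (κ * q) * (1 + q) := by ring
    rw [e, hqk]
    nlinarith [mul_nonneg hM hq0, mul_nonneg hκ.le hq0]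
  set ρ := μ * ℓ with hρ
  have hρp : 0 < ρ := by positivity
  have hx1m : x1 ∈ Icc X1 X2 := by
    rcases hx1 with rfl | rfl
    · exact left_mem_Icc.2 hXX.le
    · exact right_mem_Icc.2 hXX.le
  have h' : PS u κ M X1 X2 s0 t := h.mono le_rfl le_rfl le_rfl ht.2
  -- minimum on the positive side
  obtain ⟨τm, hτm, hmin⟩ := isCompact_Icc.exists_isMinOn (nonempty_Icc.2 ht.1.le) (h'.cont_t hx1m)
  set δ := u x1 τm with hδ
  have hδp : 0 < δ := hp τm ⟨hτm.1, hτm.2.trans ht.2⟩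
  set E : ℝ → ℝ → ℝ := fun y τ => Real.exp (μ * (d * (y - x0)) - ρ * (t - τ)) with hE
  set ε := δ / Real.exp (μ * (X2 - X1)) with hε
  have hεp : 0 < ε := by positivity
  have hEp : ∀ y τ, 0 < E y τ := fun y τ => Real.exp_pos _
  have hEt : ∀ y τ, HasDerivAt (E y) (ρ * E y τ) τ := by
    intro y τ
    have h0 : HasDerivAt (fun τ => μ * (d * (y - x0)) - ρ * (t - τ)) ρ τ := by
      have := (((hasDerivAt_id τ).const_sub t).const_mul ρ).const_sub (μ * (d * (y - x0)))
      simpa using this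
    have := h0.exp
    simpa [hE, mul_comm] using this
  have hEx : ∀ y τ, HasDerivAt (fun y => E y τ) (μ * d * E y τ) y := by
    intro y τ
    have h0 : HasDerivAt (fun y => μ * (d * (y - x0)) - ρ * (t - τ)) (μ * d) y := by
      have := ((((hasDerivAt_id y).sub_const x0).const_mul d).const_mul μ).sub_const (ρ * (t - τ))
      simpa using this
    have := h0.exp
    simpa [hE, mul_comm] using this
  have hres := h'.cmp hκ.le (fun y τ => ε * (E y τ - 1)) (fun y τ => ε * (ρ * E y τ))
    (fun y τ => ε * (μ * d * E y τ)) (fun y τ => ε * (μ * d * (μ * d * E y τ)))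
    (by simp only [hE]; fun_prop)
    (fun y τ => ((hEt y τ).sub_const 1).const_mul ε)
    (fun y τ => ((hEx y τ).sub_const 1).const_mul ε)
    (fun y τ => ((hEx y τ).const_mul (μ * d)).const_mul ε) ?_ ?_ ?_ ?_ x ⟨hx.1.le, hx.2.le⟩ t
    ⟨ht.1.le, le_rfl⟩
  · refine lt_of_lt_of_le ?_ hres
    apply mul_pos hεp
    have : 1 < E x t := by
      simp only [hE, sub_self, mul_zero, sub_zero]
      rw [Real.one_lt_exp_iff]; positivity
    linarith
  · intro y hy τ hτ hlt a b c ha hb hc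
    have hu0 := hnn y ⟨hy.1.le, hy.2.le⟩ τ ⟨hτ.1, hτ.2.trans ht.2⟩
    have hB : 0 < E y τ - 1 := by
      have : 0 < ε * (E y τ - 1) := lt_of_le_of_lt hu0 hlt
      exact (mul_pos_iff_of_pos_left hεp).1 this
    have e1 : a * (ε * (μ * d * (μ * d * E y τ))) + b * (ε * (μ * d * E y τ)) +
        c * (ε * (E y τ - 1)) - ε * (ρ * E y τ) =
        ε * ((a * μ^2 * (d*d) + b * d * μ - ρ) * E y τ + c * (E y τ - 1)) := by ring
    have hbd : - M ≤ b * d := by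
      have : |b * d| ≤ M := by rw [abs_mul, hdabs, mul_one]; exact hb
      exact (abs_le.1 this).1
    have hcl := (abs_le.1 hc).1
    have e2 : 0 ≤ (a * μ^2 * (d*d) + b * d * μ - ρ) * E y τ + c * (E y τ - 1) := by
      rw [hdd]
      have f1 : M ≤ a * μ^2 * 1 + b * d * μ - ρ := by nlinarith
      have f2 : M * E y τ ≤ (a * μ^2 * 1 + b * d * μ - ρ) * E y τ :=
        mul_le_mul_of_nonneg_right f1 (hEp y τ).le
      nlinarith
    have := mul_nonneg hεp.le e2
    linarith
  · intro y hy
    have : E y s0 ≤ 1 := by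
      simp only [hE]
      rw [Real.exp_le_one_iff]
      have : ρ * (t - s0) = μ * (X2 - X1) := by rw [hρ, hℓ]; field_simp
      rw [this]
      have := mul_le_mul_of_nonneg_left (hdb y hy) (by linarith : (0:ℝ) ≤ μ)
      linarith
    have h2 := hbot y hy
    have : ε * (E y s0 - 1) ≤ 0 := mul_nonpos_of_nonneg_of_nonpos hεp.le (by linarith)
    linarith
  all_goals
    intro τ hτ
    have hτ0 : τ ∈ Icc s0 t0 := ⟨hτ.1, hτ.2.trans ht.2⟩
    have hside : ∀ X, X = X1 ∨ X = X2 → 0 ≤ u X τ → ε * (E X τ - 1) ≤ u X τ := by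
      intro X hX hu
      rcases hd01 X hX with h0 | h1
      · have : E X τ ≤ 1 := by
          simp only [hE, h0, sub_self, mul_zero, zero_sub]
          rw [Real.exp_le_one_iff]
          have : 0 ≤ ρ * (t - τ) := mul_nonneg hρp.le (by linarith [hτ.2])
          linarith
        have : ε * (E X τ - 1) ≤ 0 := mul_nonpos_of_nonneg_of_nonpos hεp.le (by linarith)
        linarith
      · rw [h1]
        have h2 : δ ≤ u x1 τ := hmin hτ
        have h3 : E x1 τ ≤ Real.exp (μ * (X2 - X1)) := by
          simp only [hE]
          apply Real.exp_le_exp.2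
          have := mul_le_mul_of_nonneg_left (hdb x1 hx1m) (by linarith : (0:ℝ) ≤ μ)
          have : 0 ≤ ρ * (t - τ) := mul_nonneg hρp.le (by linarith [hτ.2])
          linarith
        have h4 : ε * Real.exp (μ * (X2 - X1)) = δ := by rw [hε]; field_simp
        have h5 := mul_le_mul_of_nonneg_left h3 hεp.le
        linarith
  · exact hside X1 (Or.inl rfl) (hl1 τ hτ0)
  · exact hside X2 (Or.inr rfl) (hl2 τ hτ0)


theorem const_sign {f : ℝ → ℝ} {I : Set ℝ} (hI : I.OrdConnected) (hf : ContinuousOn f I)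
    (hne : ∀ x ∈ I, f x ≠ 0) : (∀ x ∈ I, 0 < f x) ∨ (∀ x ∈ I, f x < 0) := by
  by_contra hcon
  push Not at hcon
  obtain ⟨⟨x, hx, hfx⟩, ⟨y, hy, hfy⟩⟩ := hcon
  have := hI.isPreconnected.intermediate_value hx hy hf ⟨hfx, hfy⟩
  obtain ⟨z, hz, hz0⟩ := this
  exact hne z hz hz0

theorem sq_lemma (f : ℝ → ℝ) (n : ℕ) : ∀ (I : Set ℝ), I.OrdConnected → ContinuousOn f I →
    ∀ Zs : Finset ℝ, (∀ x, x ∈ Zs ↔ x ∈ I ∧ f x = 0) → Zs.card = n →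
    ∃ S ⊆ Zs, ∃ e : ℝ, (e = 1 ∨ e = -1) ∧ ∀ x ∈ I, 0 ≤ e * (∏ z ∈ S, (x - z)) * f x := by
  induction n with
  | zero =>
    intro I hI hf Zs hZ hc
    rw [Finset.card_eq_zero] at hc
    subst hc
    have hne : ∀ x ∈ I, f x ≠ 0 := fun x hx h0 => by
      have := (hZ x).2 ⟨hx, h0⟩
      simp at this
    refine ⟨∅, le_rfl, ?_⟩
    rcases const_sign hI hf hne with h | h
    · exact ⟨1, Or.inl rfl, fun x hx => by simpa using (h x hx).le⟩
    · exact ⟨-1, Or.inr rfl, fun x hx => by simpa using (h x hx).le⟩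
  | succ n ih =>
    intro I hI hf Zs hZ hc
    have hne : Zs.Nonempty := by rw [← Finset.card_pos]; omega
    set z := Zs.max' hne with hz
    have hzm : z ∈ Zs := Zs.max'_mem hne
    have hzI := (hZ z).1 hzm
    obtain ⟨S, hS, e, he, hSe⟩ := ih (I ∩ Iio z) (hI.inter ordConnected_Iio)
      (hf.mono inter_subset_left) (Zs.erase z) (by
        intro x
        rw [Finset.mem_erase, hZ]
        constructor
        · rintro ⟨h1, h2, h3⟩
          exact ⟨⟨h2, lt_of_le_of_ne (Zs.le_max' x ((hZ x).2 ⟨h2, h3⟩)) h1⟩, h3⟩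
        · rintro ⟨⟨h2, h4⟩, h3⟩
          exact ⟨ne_of_lt h4, h2, h3⟩) (by rw [Finset.card_erase_of_mem hzm]; omega)
    have hSlt : ∀ w ∈ S, w < z := by
      intro w hw
      have h1 := hS hw
      rw [Finset.mem_erase] at h1
      exact lt_of_le_of_ne (Zs.le_max' w h1.2) h1.1
    have hzS : z ∉ S := fun h => (hSlt z h).ne rfl
    have hSZ : S ⊆ Zs := hS.trans (Finset.erase_subset _ _)
    have hQ : ∀ x, z < x → 0 < ∏ w ∈ S, (x - w) := fun x hx =>
      Finset.prod_pos fun w hw => by linarith [hSlt w hw]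
    have hK := const_sign (hI.inter (ordConnected_Ioi (a := z))) (hf.mono inter_subset_left) (by
      rintro x ⟨hx, hx2⟩ h0
      have := Zs.le_max' x ((hZ x).2 ⟨hx, h0⟩)
      exact absurd hx2 (not_lt.2 this))
    have hK' : (∀ x ∈ I ∩ Ioi z, 0 ≤ e * f x) ∨ (∀ x ∈ I ∩ Ioi z, 0 ≤ -e * f x) := by
      rcases he with rfl | rfl <;> rcases hK with h | h
      · left; intro x hx; linarith [h x hx]
      · right; intro x hx; linarith [h x hx]
      · right; intro x hx; linarith [h x hx]
      · left; intro x hx; linarith [h x hx]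
    rcases hK' with hK' | hK'
    · refine ⟨S, hSZ, e, he, fun x hx => ?_⟩
      rcases lt_trichotomy x z with h | h | h
      · exact hSe x ⟨hx, h⟩
      · rw [h, hzI.2]; simp
      · have := mul_nonneg (hQ x h).le (hK' x ⟨hx, h⟩)
        linarith
    · refine ⟨insert z S, Finset.insert_subset hzm hSZ, -e, by rcases he with rfl | rfl <;> simp,
        fun x hx => ?_⟩
      rw [Finset.prod_insert hzS]
      rcases lt_trichotomy x z with h | h | h
      · have h1 := mul_nonneg (sub_nonneg.2 h.le) (hSe x ⟨hx, h⟩)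
        linarith
      · rw [h, hzI.2]; simp
      · have h1 := mul_nonneg (sub_nonneg.2 h.le) (mul_nonneg (hQ x h).le (hK' x ⟨hx, h⟩))
        linarith

def C2B (g : ℝ → ℝ) (X1 X2 N : ℝ) : Prop := 0 ≤ N ∧ ∃ g1 g2 : ℝ → ℝ,
  (∀ y, HasDerivAt g (g1 y) y) ∧ (∀ y, HasDerivAt g1 (g2 y) y) ∧
  ∀ y ∈ Icc X1 X2, |g y| ≤ N ∧ |g1 y| ≤ N ∧ |g2 y| ≤ N

theorem C2B.mul {g h : ℝ → ℝ} {X1 X2 N N' : ℝ} (hg : C2B g X1 X2 N) (hh : C2B h X1 X2 N') :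
    C2B (fun x => g x * h x) X1 X2 (4 * N * N') := by
  obtain ⟨hN, g1, g2, a1, a2, a3⟩ := hg
  obtain ⟨hN', h1, h2, b1, b2, b3⟩ := hh
  refine ⟨by positivity, fun x => g1 x * h x + g x * h1 x,
    fun x => (g2 x * h x + g1 x * h1 x) + (g1 x * h1 x + g x * h2 x),
    fun y => (a1 y).mul (b1 y), fun y => ((a2 y).mul (b1 y)).add ((a1 y).mul (b2 y)), ?_⟩
  intro y hy
  obtain ⟨p1, p2, p3⟩ := a3 y hy
  obtain ⟨q1, q2, q3⟩ := b3 y hy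
  have key : ∀ p q : ℝ, |p| ≤ N → |q| ≤ N' → |p * q| ≤ N * N' := fun p q hp hq => by
    rw [abs_mul]; exact mul_le_mul hp hq (abs_nonneg _) hN
  have hNN : 0 ≤ N * N' := by positivity
  have k1 := key _ _ p1 q1
  have k2 := key _ _ p2 q1
  have k3 := key _ _ p1 q2
  have k4 := key _ _ p3 q1
  have k5 := key _ _ p2 q2
  have k6 := key _ _ p1 q3
  rw [abs_le] at k1 k2 k3 k4 k5 k6
  refine ⟨?_, ?_, ?_⟩ <;> rw [abs_le] <;> constructor <;> linarith

theorem C2B.one {X1 X2 : ℝ} : C2B (fun _ => 1) X1 X2 1 :=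
  ⟨zero_le_one, fun _ => 0, fun _ => 0, fun y => hasDerivAt_const _ _, fun y => hasDerivAt_const _ _,
    fun y _ => by simp⟩

theorem C2B.lin {X1 X2 z : ℝ} (hX : X1 ≤ X2) (hz : z ∈ Icc X1 X2) :
    C2B (fun x => x - z) X1 X2 (X2 - X1 + 1) :=
  ⟨by linarith, fun _ => 1, fun _ => 0, fun y => (hasDerivAt_id y).sub_const z,
    fun y => hasDerivAt_const _ _, fun y hy => by
      obtain ⟨h1, h2⟩ := hz
      obtain ⟨h3, h4⟩ := hy
      refine ⟨?_, ?_, ?_⟩ <;> rw [abs_le] <;> constructor <;> linarith⟩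

theorem C2B.mono {g : ℝ → ℝ} {X1 X2 N N' : ℝ} (hg : C2B g X1 X2 N) (h : N ≤ N') :
    C2B g X1 X2 N' := by
  obtain ⟨hN, g1, g2, a1, a2, a3⟩ := hg
  exact ⟨hN.trans h, g1, g2, a1, a2, fun y hy =>
    ⟨(a3 y hy).1.trans h, (a3 y hy).2.1.trans h, (a3 y hy).2.2.trans h⟩⟩

theorem C2B.prod {X1 X2 : ℝ} (hX : X1 ≤ X2) (S : Finset ℝ) : (∀ z ∈ S, z ∈ Icc X1 X2) →
    C2B (fun x => ∏ z ∈ S, (x - z)) X1 X2 ((4 * (X2 - X1 + 1)) ^ S.card) := by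
  classical
  induction S using Finset.induction_on with
  | empty => intro _; simpa using C2B.one
  | insert z S hz ih =>
    intro h
    have h1 := ih fun w hw => h w (Finset.mem_insert_of_mem hw)
    have h2 := (C2B.lin hX (h z (Finset.mem_insert_self _ _))).mul h1
    simp only [Finset.prod_insert hz, Finset.card_insert_of_notMem hz]
    refine h2.mono (le_of_eq ?_)
    ring

theorem alt_roots (S : Finset ℝ) (n : ℕ) (y : Fin (n+2) → ℝ) (hy : Monotone y) (e0 : ℝ)
    (h : ∀ i : Fin (n+2), 0 < (-1:ℝ)^(i:ℕ) * (e0 * ∏ z ∈ S, (y i - z))) : n + 1 ≤ S.card := by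
  have hr : ∀ i : Fin (n+1), ∃ r ∈ S, y i.castSucc < r ∧ r < y i.succ := by
    intro i
    have h1 := h i.castSucc
    have h2 := h i.succ
    simp only [Fin.val_castSucc, Fin.val_succ, pow_succ] at h1 h2
    have hle : y i.castSucc ≤ y i.succ := hy (Fin.castSucc_le_succ i)
    have hc : ContinuousOn (fun x => (-1:ℝ)^(i:ℕ) * (e0 * ∏ z ∈ S, (x - z)))
      (Icc (y i.castSucc) (y i.succ)) := by
      apply Continuous.continuousOn; fun_prop
    have := intermediate_value_Icc' hle hc (show (0:ℝ) ∈ _ from ⟨by linarith, h1.le⟩)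
    obtain ⟨r, hrI, hr0⟩ := this
    simp only at hr0
    have he0 : e0 ≠ 0 := by rintro rfl; simp at h1
    have h10 : (-1:ℝ)^(i:ℕ) ≠ 0 := by positivity
    have hp : ∏ z ∈ S, (r - z) = 0 := by
      rcases mul_eq_zero.1 hr0 with h | h
      · exact absurd h h10
      · exact (mul_eq_zero.1 h).resolve_left he0
    have hrS : r ∈ S := by
      obtain ⟨z, hz, hz0⟩ := Finset.prod_eq_zero_iff.1 hp
      rw [sub_eq_zero.1 hz0]; exact hz
    refine ⟨r, hrS, lt_of_le_of_ne hrI.1 ?_, lt_of_le_of_ne hrI.2 ?_⟩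
    · rintro h; rw [h, hp] at h1; simp at h1
    · rintro h; rw [← h, hp] at h2; simp at h2
  choose r hrS hr1 hr2 using hr
  have hmono : StrictMono r := by
    rw [Fin.strictMono_iff_lt_succ]
    intro i
    have h3 := hr1 i.succ
    rw [← Fin.succ_castSucc] at h3
    exact (hr2 _).trans h3
  have := Finset.card_le_card_of_injOn (s := Finset.univ) r (fun i _ => hrS i) hmono.injective.injOn
  simpa using this

theorem side_bound {f : ℝ → ℝ} {s t : ℝ} (hf : ContinuousOn f (Icc s t))
    (h : (∀ τ ∈ Icc s t, f τ = 0) ∨ (∀ τ ∈ Icc s t, f τ ≠ 0)) :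
    ∃ μ > 0, ∀ σ : ℝ, (σ = 1 ∨ σ = -1) → ∀ τ ∈ Icc s t, 0 < σ * f τ →
      ∀ τ' ∈ Icc s t, μ ≤ σ * f τ' := by
  rcases h with h | h
  · refine ⟨1, one_pos, fun σ _ τ hτ h0 => ?_⟩
    rw [h τ hτ] at h0; simp at h0
  · rcases lt_or_ge t s with hst | hst
    · refine ⟨1, one_pos, fun σ _ τ hτ => ?_⟩
      exact absurd (hτ.1.trans hτ.2) (not_le.2 hst)
    obtain ⟨τm, hτm, hmin⟩ := isCompact_Icc.exists_isMinOn (nonempty_Icc.2 hst) hf.abs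
    refine ⟨|f τm|, abs_pos.2 (h _ hτm), ?_⟩
    intro σ hσ τ hτ h0 τ' hτ'
    have h1 : |f τm| ≤ |f τ'| := hmin hτ'
    refine h1.trans (le_of_eq ?_)
    rcases const_sign ordConnected_Icc hf h with hc | hc
    · rcases hσ with rfl | rfl
      · rw [abs_of_pos (hc _ hτ')]; ring
      · have := hc _ hτ; linarith
    · rcases hσ with rfl | rfl
      · have := hc _ hτ; linarith
      · rw [abs_of_neg (hc _ hτ')]; ring


theorem sgn_pow (i : ℕ) (e : ℝ) (he : e = 1 ∨ e = -1) : (-1:ℝ)^i * e = 1 ∨ (-1:ℝ)^i * e = -1 := by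
  rcases neg_one_pow_eq_or ℝ i with h | h <;> rcases he with rfl | rfl <;> simp [h]

theorem key_evolve {u : ℝ → ℝ → ℝ} {κ M X1 X2 s t' : ℝ} (h : PS u κ M X1 X2 s t') (hκ : 0 ≤ κ)
    (hM : 0 ≤ M) (hst : s ≤ t') {P0 : ℝ → ℝ} {N0 : ℝ} (hP : C2B P0 X1 X2 N0)
    (hX1 : P0 X1 = 0) (hX2 : P0 X2 = 0) {A : ℝ} (hA : 0 < A)
    (hwin : (t' - s) * (M + 1 + 9 * (M * N0) / A) ≤ 1) {ε : ℝ} (hε : 0 < ε)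
    (hlat : ∀ X, X = X1 ∨ X = X2 → ∀ σ : ℝ, (σ = 1 ∨ σ = -1) → ∀ τ ∈ Icc s t', 0 < σ * u X τ →
      ∀ τ' ∈ Icc s t', ε * A ≤ σ * u X τ')
    {e e' : ℝ} (he : e = 1 ∨ e = -1) (he' : e' = 1 ∨ e' = -1) (n : ℕ)
    (hy : ∃ y : Fin (n+1) → ℝ, Monotone y ∧ ∀ i, y i ∈ Icc X1 X2 ∧
      ε * A ≤ (-1)^(i:ℕ) * (e' * (u (y i) t' + ε * e * P0 (y i)))) :
    ∃ y : Fin (n+1) → ℝ, Monotone y ∧ ∀ i, y i ∈ Icc X1 X2 ∧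
      0 < (-1)^(i:ℕ) * (e' * (u (y i) s + ε * e * P0 (y i))) := by
  obtain ⟨hN0, g1, g2, hg1, hg2, hgb⟩ := hP
  set R := M + 1 + 9 * (M * N0) / A with hR
  have hRp : 0 < R := by positivity
  have hlamd : ∀ τ, HasDerivAt (fun τ => ε * A * Real.exp (R*(τ - t')))
      (ε * A * (Real.exp (R*(τ - t')) * R)) τ := by
    intro τ
    have h0 : HasDerivAt (fun τ => R*(τ - t')) R τ := by
      simpa using ((hasDerivAt_id τ).sub_const t').const_mul R
    exact h0.exp.const_mul _
  have hcP : Continuous P0 := continuous_iff_continuousAt.2 fun x => (hg1 x).continuousAt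
  have hlam1 : ∀ τ ≤ t', ε * A * Real.exp (R*(τ - t')) ≤ ε * A := by
    intro τ hτ
    have : Real.exp (R*(τ - t')) ≤ 1 := Real.exp_le_one_iff.2
      (mul_nonpos_of_nonneg_of_nonpos hRp.le (by linarith))
    exact mul_le_of_le_one_right (by positivity) this
  have hlam3 : ∀ τ ∈ Icc s t', ε * A / 3 ≤ ε * A * Real.exp (R*(τ - t')) := by
    intro τ hτ
    have h1 : -1 ≤ R*(τ - t') := by
      have : (t' - τ) * R ≤ (t' - s) * R := mul_le_mul_of_nonneg_right (by linarith [hτ.1]) hRp.le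
      linarith
    have h2 : Real.exp (-1) ≤ Real.exp (R*(τ - t')) := Real.exp_le_exp.2 h1
    have h3 : (1:ℝ)/3 ≤ Real.exp (-1) := by
      rw [Real.exp_neg, ← one_div]
      exact one_div_le_one_div_of_le (Real.exp_pos _) (by linarith [Real.exp_one_lt_d9])
    have := mul_le_mul_of_nonneg_left (h3.trans h2) (by positivity : 0 ≤ ε * A)
    linarith
  have := alt_lemma n (fun x τ => e' * (u x τ + ε * e * P0 x))
    (fun τ => ε * A * Real.exp (R*(τ - t'))) X1 X2 s t' hst ?_ (by fun_prop)
    (fun τ => by positivity) ?_ ?_ ?_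
  · obtain ⟨y, hm, hy⟩ := this
    refine ⟨y, hm, fun i => ⟨(hy i).1, lt_of_lt_of_le ?_ (hy i).2⟩⟩
    positivity
  · have : ContinuousOn (fun p : ℝ × ℝ => ε * e * P0 p.1) (Icc X1 X2 ×ˢ Icc s t') := by
      apply Continuous.continuousOn; fun_prop
    exact (h.1.add this).const_mul e'
  · intro X hX i τ hτ hle τ' hτ'
    have hPX : P0 X = 0 := by rcases hX with rfl | rfl <;> assumption
    simp only [hPX, mul_zero, add_zero, ← mul_assoc] at hle ⊢
    have h1 := hlat X hX _ (sgn_pow i e' he') τ hτ (lt_of_lt_of_le (by positivity) hle) τ'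
      ⟨hτ'.1, hτ'.2.trans hτ.2⟩
    exact (hlam1 _ (hτ'.2.trans hτ.2)).trans h1
  · intro i x hx τ hτ hmax heq
    have hσ := sgn_pow i e' he'
    set σ := (-1:ℝ)^(i:ℕ) * e' with hσd
    have hτ' : τ ∈ Icc s t' := ⟨hτ.1.le, hτ.2⟩
    have hfe : (fun y => (-1:ℝ)^(i:ℕ) * (e' * (u y τ + ε * e * P0 y))) =
        fun y => σ * u y τ + (σ * ε * e) * P0 y := by
      ext y; rw [hσd]; ring
    rw [hfe] at hmax
    have heq' : σ * u x τ + (σ * ε * e) * P0 x = ε * A * Real.exp (R*(τ - t')) := by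
      rw [← heq, hσd]; ring
    obtain ⟨ut, a, b, c, e1, e2, e3, e4, e5, e6⟩ := (h.smul σ).localMax hκ hx hτ'
      (g := fun y => (σ * ε * e) * P0 y) (fun y => (hg1 y).const_mul _)
      ((hg2 x).const_mul _) hmax
    refine ⟨ut - ε * A * (Real.exp (R*(τ - t')) * R), ?_, ?_⟩
    · have := (e1.add_const (σ * ε * e * P0 x)).sub (hlamd τ)
      refine this.congr_of_eventuallyEq (Eventually.of_forall fun z => ?_)
      simp only [hσd, Pi.sub_apply]
      ring
    · have hxI : x ∈ Icc X1 X2 := ⟨hx.1.le, hx.2.le⟩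
      obtain ⟨p1, p2, p3⟩ := hgb x hxI
      have habs : |σ * ε * e| = ε := by
        have : |σ| = 1 := by rcases hσ with h | h <;> rw [h] <;> simp
        have h2 : |e| = 1 := by rcases he with h | h <;> rw [h] <;> simp
        rw [abs_mul, abs_mul, this, h2, abs_of_pos hε]; ring
      set q := σ * ε * e with hq
      have bnd : ∀ a p : ℝ, |a| ≤ M → |p| ≤ N0 → |a * (q * p)| ≤ ε * (M * N0) := by
        intro a p ha hp
        rw [abs_mul, abs_mul, habs]
        have := mul_le_mul ha hp (abs_nonneg _) hM
        have := mul_le_mul_of_nonneg_left this hε.le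
        linarith
      have k1 := bnd a (g2 x) (by rw [abs_le]; constructor <;> linarith) p3
      have k2 := bnd b (g1 x) e4 p2
      have k3 := bnd c (P0 x) e5 p1
      rw [abs_le] at k1 k2 k3
      set lam := ε * A * Real.exp (R*(τ - t')) with hlam
      have hlp : 0 < lam := by positivity
      have k4 : c * lam ≤ M * lam :=
        mul_le_mul_of_nonneg_right (le_abs_self c |>.trans e5) hlp.le
      have k5 : c * (σ * u x τ) = c * lam - c * (q * P0 x) := by rw [← heq']; ring
      have k6 : ε * A * (Real.exp (R*(τ - t')) * R) = lam * R := by rw [hlam]; ring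
      have k7 := hlam3 τ hτ'
      rw [← hlam] at k7
      have k8 : ε * A / 3 * (1 + 9 * (M * N0) / A) ≤ lam * (1 + 9 * (M * N0) / A) :=
        mul_le_mul_of_nonneg_right k7 (by positivity)
      have k9 : ε * A / 3 * (1 + 9 * (M * N0) / A) = ε * A / 3 + 3 * (ε * (M * N0)) := by
        field_simp
        ring
      have k10 : lam * R = M * lam + lam * (1 + 9 * (M * N0) / A) := by rw [hR]; ring
      have k11 : 0 < ε * A := by positivity
      rw [k6]
      linarith
  · obtain ⟨y, hm, hy⟩ := hy
    exact ⟨y, hm, fun i => ⟨(hy i).1, by simpa using (hy i).2⟩⟩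

theorem Hfun (X1 X2 ω l m : ℝ) (hl : 0 < l) (hω : 0 < ω) (hX : X1 ≤ X2) (hm : m ∈ Icc X1 X2) :
    C2B (fun x => Real.cos (ω * (x - m)) + (x - m)^2 / l^2) X1 X2
      (1 + ω + ω^2 + ((X2-X1)^2 + 2 * (X2 - X1) + 2) / l^2) := by
  have hL : 0 ≤ X2 - X1 := by linarith
  refine ⟨by positivity, fun x => - Real.sin (ω * (x - m)) * ω + 2 * (x - m) / l^2,
    fun x => - (Real.cos (ω * (x - m)) * ω) * ω + 2 / l^2, ?_, ?_, ?_⟩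
  · intro y
    have h0 : HasDerivAt (fun x => ω * (x - m)) ω y := by
      simpa using ((hasDerivAt_id y).sub_const m).const_mul ω
    have h1 : HasDerivAt (fun x => (x - m)^2 / l^2) (2 * (y - m) / l^2) y := by
      have := (((hasDerivAt_id y).sub_const m).pow 2).div_const (l^2)
      simpa using this
    exact h0.cos.add h1
  · intro y
    have h0 : HasDerivAt (fun x => ω * (x - m)) ω y := by
      simpa using ((hasDerivAt_id y).sub_const m).const_mul ω
    have h1 : HasDerivAt (fun x => 2 * (x - m) / l^2) (2 / l^2) y := by
      have := (((hasDerivAt_id y).sub_const m).const_mul 2).div_const (l^2)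
      simpa using this
    exact (h0.sin.neg.mul_const ω).add h1
  · intro y hy
    have hd : |y - m| ≤ X2 - X1 := by
      rw [abs_le]; constructor <;> linarith [hy.1, hy.2, hm.1, hm.2]
    have c1 := Real.abs_cos_le_one (ω * (y - m))
    have c2 := Real.abs_sin_le_one (ω * (y - m))
    have hl2 : 0 < l^2 := by positivity
    have split : ((X2-X1)^2 + 2 * (X2 - X1) + 2) / l^2 = (X2-X1)^2 / l^2 + 2 * (X2 - X1) / l^2
      + 2 / l^2 := by ring
    rw [split]
    have d1 : |(y-m)^2 / l^2| ≤ (X2-X1)^2 / l^2 := by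
      rw [abs_div, abs_pow, abs_of_pos hl2]; gcongr
    have d2 : |2 * (y-m) / l^2| ≤ 2 * (X2-X1) / l^2 := by
      rw [abs_div, abs_mul, abs_of_pos hl2, abs_of_pos (by norm_num : (0:ℝ) < 2)]; gcongr
    have d3 : |2 / l^2| ≤ 2 / l^2 := by rw [abs_of_pos (by positivity)]
    have n1 : 0 ≤ (X2-X1)^2 / l^2 := by positivity
    have n2 : 0 ≤ 2 * (X2-X1) / l^2 := by positivity
    have n3 : 0 ≤ 2 / l^2 := by positivity
    have n4 : 0 ≤ ω^2 := by positivity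
    refine ⟨?_, ?_, ?_⟩
    · refine (abs_add_le _ _).trans ?_
      linarith
    · refine (abs_add_le _ _).trans ?_
      have : |- Real.sin (ω * (y - m)) * ω| ≤ ω := by
        rw [abs_mul, abs_neg, abs_of_pos hω]; exact mul_le_of_le_one_left hω.le c2
      linarith
    · refine (abs_add_le _ _).trans ?_
      have : |- (Real.cos (ω * (y - m)) * ω) * ω| ≤ ω^2 := by
        rw [abs_mul, abs_neg, abs_mul, abs_of_pos hω, mul_assoc, ← sq]
        exact mul_le_of_le_one_left n4 c1
      linarith


set_option maxHeartbeats 2000000 in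
theorem key {u : ℝ → ℝ → ℝ} {κ M X1 X2 τ0 t' : ℝ} (h : PS u κ M X1 X2 τ0 t') (hκ : 0 ≤ κ)
    (hM : 0 ≤ M)
    (hl1 : (∀ τ ∈ Icc τ0 t', u X1 τ = 0) ∨ (∀ τ ∈ Icc τ0 t', u X1 τ ≠ 0))
    (hl2 : (∀ τ ∈ Icc τ0 t', u X2 τ = 0) ∨ (∀ τ ∈ Icc τ0 t', u X2 τ ≠ 0))
    {α β : ℝ} (hX : X1 ≤ X2) (hα : X1 ≤ α) (hβ : β ≤ X2) (hz : ∀ x ∈ Icc α β, u x t' = 0)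
    (n : ℕ) (l : ℝ) (hl : 0 < l)
    (hs : ∀ η > 0, ∃ s ∈ Ioo (t' - η) t', τ0 ≤ s ∧ ∃ m, α ≤ m - l ∧ m + l ≤ β ∧
      (∀ x ∈ Icc (m - l) (m + l), u x s ≠ 0) ∧
      ∃ S : Finset ℝ, (∀ z ∈ S, z ∈ Icc X1 X2 ∧ u z s = 0) ∧ S.card ≤ n ∧
        ∃ e : ℝ, (e = 1 ∨ e = -1) ∧ ∀ x ∈ Icc X1 X2, 0 ≤ e * (∏ z ∈ S, (x - z)) * u x s) :
    False := by
  set ω : ℝ := 2 * (n + 1) * Real.pi / l with hω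
  have hωp : 0 < ω := by have := Real.pi_pos; positivity
  set NH : ℝ := 1 + ω + ω^2 + ((X2-X1)^2 + 2 * (X2 - X1) + 2) / l^2 with hNH
  set N0 : ℝ := 4 * (4 * (X2 - X1 + 1))^n * (4 * (X2-X1+1) * (4 * (X2-X1+1) * NH)) with hN0
  have hLp : 0 ≤ X2 - X1 := by linarith
  have hNHp : 0 ≤ NH := by positivity
  have hN0p : 0 ≤ N0 := by positivity
  set ρ : ℝ := min (l/2) 1 with hρ
  have hρp : 0 < ρ := lt_min (by linarith) one_pos
  have hρ1 : ρ ≤ 1 := min_le_right _ _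
  have hρl : ρ ≤ l / 2 := min_le_left _ _
  set A : ℝ := ρ^n * ((l/2) * ((l/2) * (1/2))) with hA
  have hAp : 0 < A := by positivity
  set R := M + 1 + 9 * (M * N0) / A with hR
  have hRp : 0 < R := by positivity
  obtain ⟨s, hsI, hsτ, m, hm1, hm2, hcell, S, hS, hSn, e, he, hQ⟩ := hs (1/R) (by positivity)
  have hst : s ≤ t' := hsI.2.le
  have h' : PS u κ M X1 X2 s t' := h.mono le_rfl le_rfl hsτ le_rfl
  have hmI : m ∈ Icc X1 X2 := ⟨by linarith, by linarith⟩
  have hcX : ∀ x ∈ Icc (m - l) (m + l), x ∈ Icc X1 X2 := fun x hx =>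
    ⟨by linarith [hx.1], by linarith [hx.2]⟩
  set Q : ℝ → ℝ := fun x => ∏ z ∈ S, (x - z) with hQd
  set H : ℝ → ℝ := fun x => Real.cos (ω * (x - m)) + (x - m)^2 / l^2 with hH
  set P0 : ℝ → ℝ := fun x => Q x * ((x - X1) * ((x - X2) * H x)) with hP0
  have hC : C2B P0 X1 X2 N0 := by
    have c1 := (C2B.prod hX S fun z hz => (hS z hz).1).mono
      (pow_le_pow_right₀ (by linarith) hSn)
    have c2 := Hfun X1 X2 ω l m hl hωp hX hmI
    exact c1.mul ((C2B.lin hX ⟨le_rfl, hX⟩).mul ((C2B.lin hX ⟨hX, le_rfl⟩).mul c2))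
  have hPb : ∀ x ∈ Icc X1 X2, |P0 x| ≤ N0 := by
    obtain ⟨-, g1, g2, -, -, hb⟩ := hC
    exact fun x hx => (hb x hx).1
  have hPX1 : P0 X1 = 0 := by simp [hP0]
  have hPX2 : P0 X2 = 0 := by simp [hP0]
  obtain ⟨μ1, hμ1, hb1⟩ := side_bound (h.cont_t ⟨le_rfl, hX⟩) hl1
  obtain ⟨μ2, hμ2, hb2⟩ := side_bound (h.cont_t ⟨hX, le_rfl⟩) hl2
  obtain ⟨xm, hxm, hmin⟩ := (isCompact_Icc (a := m - l) (b := m + l)).exists_isMinOn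
    (nonempty_Icc.2 (by linarith))
    (((h.cont_x (τ := s) ⟨hsτ, hst⟩).mono fun x hx => hcX x hx).abs)
  set ν := |u xm s| with hν
  have hνp : 0 < ν := abs_pos.2 (hcell _ hxm)
  obtain ⟨ε, hε, hε1, hε2, hε3⟩ : ∃ ε > 0, ε * A ≤ μ1 ∧ ε * A ≤ μ2 ∧ ε * N0 ≤ ν := by
    refine ⟨min (min (μ1/A) (μ2/A)) (ν/(N0+1)), by positivity, ?_, ?_, ?_⟩
    · rw [← le_div_iff₀ hAp]; exact (min_le_left _ _).trans (min_le_left _ _)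
    · rw [← le_div_iff₀ hAp]; exact (min_le_left _ _).trans (min_le_right _ _)
    · have : min (min (μ1/A) (μ2/A)) (ν/(N0+1)) ≤ ν/(N0+1) := min_le_right _ _
      rw [le_div_iff₀ (by positivity)] at this
      have h2 : 0 < min (min (μ1/A) (μ2/A)) (ν/(N0+1)) := by positivity
      linarith
  have hQne : ∀ x ∈ Icc (m - l) (m + l), Q x ≠ 0 := by
    intro x hx h0
    obtain ⟨z, hz, hz0⟩ := Finset.prod_eq_zero_iff.1 h0
    have : x = z := sub_eq_zero.1 hz0
    exact hcell x hx (this ▸ (hS z hz).2)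
  have hQc : Continuous Q := by rw [hQd]; fun_prop
  obtain ⟨e0, he0, hQ0⟩ : ∃ e0 : ℝ, (e0 = 1 ∨ e0 = -1) ∧ ∀ x ∈ Icc (m - l) (m + l), 0 < e0 * Q x := by
    rcases const_sign ordConnected_Icc hQc.continuousOn hQne with hc | hc
    · exact ⟨1, Or.inl rfl, fun x hx => by simpa using hc x hx⟩
    · exact ⟨-1, Or.inr rfl, fun x hx => by simpa using hc x hx⟩
  have hQlow : ∀ x ∈ Icc m (m + l/2), ρ^n ≤ e0 * Q x := by
    intro x hx
    have hxc : x ∈ Icc (m - l) (m + l) := ⟨by linarith [hx.1], by linarith [hx.2]⟩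
    have h1 : e0 * Q x = |Q x| := by
      have h2 : |e0| = 1 := by rcases he0 with h | h <;> rw [h] <;> simp
      rw [← abs_of_pos (hQ0 x hxc), abs_mul, h2, one_mul]
    rw [h1, hQd]
    simp only [Finset.abs_prod]
    calc ρ^n ≤ ρ^S.card := pow_le_pow_of_le_one hρp.le hρ1 hSn
      _ = ∏ z ∈ S, ρ := by simp
      _ ≤ _ := by
        refine Finset.prod_le_prod (fun _ _ => hρp.le) fun z hz => ?_
        refine hρl.trans ?_
        by_contra hcon
        push Not at hcon
        rw [abs_lt] at hcon
        exact hcell z ⟨by linarith [hx.1], by linarith [hx.2]⟩ (hS z hz).2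
  have hee : e * e = 1 := by rcases he with rfl | rfl <;> norm_num
  have he' : e * e0 = 1 ∨ e * e0 = -1 := by rcases he with rfl | rfl <;> rcases he0 with rfl | rfl <;> simp
  have hne : -e = 1 ∨ -e = -1 := by rcases he with rfl | rfl <;> simp
  have hwin : (t' - s) * R ≤ 1 := by
    have : t' - s ≤ 1 / R := by linarith [hsI.1]
    rwa [le_div_iff₀ hRp] at this
  obtain ⟨y, hym, hy⟩ := key_evolve h' hκ hM hst hC hPX1 hPX2 hAp hwin hε (by
      intro X hX' σ hσ τ hτ h0 τ' hτ'
      have i1 : τ ∈ Icc τ0 t' := ⟨hsτ.trans hτ.1, hτ.2⟩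
      have i2 : τ' ∈ Icc τ0 t' := ⟨hsτ.trans hτ'.1, hτ'.2⟩
      rcases hX' with rfl | rfl
      · exact hε1.trans (hb1 σ hσ τ i1 h0 τ' i2)
      · exact hε2.trans (hb2 σ hσ τ i1 h0 τ' i2)) hne he' (n+1) (by
      refine ⟨fun j => m + (j:ℕ) * (l / (2 * (n+1))), ?_, ?_⟩
      · intro i j hij
        have : ((i:ℕ):ℝ) ≤ ((j:ℕ):ℝ) := by exact_mod_cast hij
        simp only
        gcongr
      · intro j
        set x := m + ((j:ℕ):ℝ) * (l / (2 * (n+1))) with hx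
        have hj : ((j:ℕ):ℝ) ≤ n + 1 := by
          have : (j:ℕ) ≤ n + 1 := by omega
          exact_mod_cast this
        have hxm' : x - m = ((j:ℕ):ℝ) * (l / (2 * (n+1))) := by rw [hx]; ring
        have hx0 : 0 ≤ x - m := by rw [hxm']; positivity
        have hx1 : x - m ≤ l / 2 := by
          rw [hxm']
          calc ((j:ℕ):ℝ) * (l / (2 * (n+1))) ≤ (n+1) * (l / (2 * (n+1))) := by gcongr
            _ = l / 2 := by field_simp
        have hxI : x ∈ Icc m (m + l/2) := ⟨by linarith, by linarith⟩
        have hxc : x ∈ Icc (m-l) (m + l) := ⟨by linarith, by linarith⟩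
        refine ⟨hcX x hxc, ?_⟩
        rw [hz x ⟨by linarith, by linarith⟩]
        have hcos : Real.cos (ω * (x - m)) = (-1)^(j:ℕ) := by
          have : ω * (x - m) = (j:ℕ) * Real.pi := by
            rw [hxm', hω]; field_simp
          rw [this, Real.cos_nat_mul_pi]
        have hHx : 1/2 ≤ (-1)^(j:ℕ) * H x := by
          have hq : (x-m)^2 / l^2 ≤ 1/4 := by
            rw [div_le_iff₀ (by positivity)]
            have := pow_le_pow_left₀ hx0 hx1 2
            linarith [show (l/2)^2 = l^2/4 by ring]
          have hq0 : 0 ≤ (x-m)^2 / l^2 := by positivity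
          simp only [hH, hcos]
          rcases neg_one_pow_eq_or ℝ (j:ℕ) with h | h <;> rw [h] <;> linarith
        have e1 : (-1)^(j:ℕ) * (e * e0 * (0 + ε * -e * P0 x)) =
            ε * ((e0 * Q x) * ((x - X1) * ((X2 - x) * ((-1)^(j:ℕ) * H x)))) := by
          simp only [hP0]
          linear_combination (ε * (-1)^(j:ℕ) * e0 * Q x * (x - X1) * (X2 - x) * H x) * hee
        rw [e1]
        refine mul_le_mul_of_nonneg_left ?_ hε.le
        rw [hA]
        have a1 : l / 2 ≤ x - X1 := by linarith
        have a2 : l / 2 ≤ X2 - x := by linarith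
        have a3 := hQlow x hxI
        have n3 : 0 ≤ e0 * Q x := (hQ0 x hxc).le
        have n1 : 0 ≤ x - X1 := by linarith
        have n2 : 0 ≤ X2 - x := by linarith
        gcongr)
  have hfin := alt_roots S n y hym e0 (by
    intro i
    obtain ⟨hyI, hyp⟩ := hy i
    change 0 < (-1:ℝ)^(i:ℕ) * (e0 * Q (y i))
    set x := y i with hx
    set W := u x s + ε * -e * P0 x with hW
    have hQW : 0 ≤ Q x * (e * W) := by
      have e1 : Q x * (e * W) = e * Q x * u x s + ε * (- (Q x * P0 x)) := by
        rw [hW]; linear_combination (-ε * Q x * P0 x) * hee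
      rw [e1]
      have q1 : 0 ≤ e * Q x * u x s := hQ x hyI
      by_cases hc : x ∈ Icc (m - l) (m + l)
      · have hu : ν ≤ |u x s| := hmin hc
        have q2 : e * Q x * u x s = |Q x| * |u x s| := by
          have h2 : |e| = 1 := by rcases he with h | h <;> rw [h] <;> simp
          rw [← abs_of_nonneg q1, abs_mul, abs_mul, h2, one_mul]
        have q3 : ε * (Q x * P0 x) ≤ |Q x| * (ε * N0) := by
          have : Q x * P0 x ≤ |Q x| * N0 := by
            refine (le_abs_self _).trans ?_
            rw [abs_mul]
            exact mul_le_mul_of_nonneg_left (hPb x hyI) (abs_nonneg _)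
          have := mul_le_mul_of_nonneg_left this hε.le
          linarith
        have q4 : |Q x| * (ε * N0) ≤ |Q x| * |u x s| :=
          mul_le_mul_of_nonneg_left (hε3.trans hu) (abs_nonneg _)
        rw [q2]
        linarith
      · have hHx : 0 ≤ H x := by
          have : l^2 ≤ (x - m)^2 := by
            rw [mem_Icc, not_and_or, not_le, not_le] at hc
            rcases hc with hc | hc
            · have := pow_le_pow_left₀ hl.le (show l ≤ m - x by linarith) 2
              linarith [show (m-x)^2 = (x-m)^2 by ring]
            · exact pow_le_pow_left₀ hl.le (show l ≤ x - m by linarith) 2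
          have h1 : 1 ≤ (x-m)^2 / l^2 := by rwa [le_div_iff₀ (by positivity), one_mul]
          have h2 := Real.neg_one_le_cos (ω * (x - m))
          simp only [hH]; linarith
        have e2 : - (Q x * P0 x) = (Q x)^2 * ((x - X1) * ((X2 - x) * H x)) := by
          simp only [hP0]; ring
        have : 0 ≤ - (Q x * P0 x) := by
          rw [e2]
          have b1 : 0 ≤ x - X1 := by linarith [hyI.1]
          have b2 : 0 ≤ X2 - x := by linarith [hyI.2]
          positivity
        have := mul_nonneg hε.le this
        linarith
    have hQx : Q x ≠ 0 := by
      intro h0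
      obtain ⟨z, hz, hz0⟩ := Finset.prod_eq_zero_iff.1 h0
      have hxz : x = z := sub_eq_zero.1 hz0
      have hu0 : u x s = 0 := hxz ▸ (hS z hz).2
      have hW0 : W = 0 := by simp only [hW, hP0, h0, hu0]; ring
      rw [hW0] at hyp
      simp at hyp
    set p := (-1:ℝ)^(i:ℕ) with hp
    have hpos : 0 < p * e0 * (e * W) := by linarith
    have h1 : 0 < |Q x| := abs_pos.2 hQx
    by_contra hcon
    push Not at hcon
    have hpne : p * e0 ≠ 0 := by intro h0; rw [h0] at hpos; simp at hpos
    have hlt : p * e0 * Q x < 0 := lt_of_le_of_ne (by linarith) (mul_ne_zero hpne hQx)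
    have hWne : e * W ≠ 0 := by intro h0; rw [h0] at hpos; simp at hpos
    have h3 : 0 < (e * W)^2 := by positivity
    have h4 := mul_nonneg hpos.le hQW
    have h5 := mul_neg_of_neg_of_pos hlt h3
    linarith)
  omega


/-- near time t (from the left, inside [t0,t]) a strict sign persists -/
theorem left_neg {f : ℝ → ℝ} {t0 t1 t : ℝ} (hf : ContinuousOn f (Icc t0 t1)) (ht : t ∈ Ioc t0 t1)
    (h : f t < 0) : ∃ s ∈ Ioo t0 t, ∀ τ ∈ Icc s t, f τ < 0 := by
  have hc : ContinuousWithinAt f (Icc t0 t1) t := hf t ⟨ht.1.le, ht.2⟩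
  have h1 : ∀ᶠ τ in 𝓝[Icc t0 t1] t, f τ < 0 := hc.eventually (gt_mem_nhds h)
  rw [eventually_nhdsWithin_iff, Metric.eventually_nhds_iff] at h1
  obtain ⟨δ, hδ, h1⟩ := h1
  have hm : max (t - δ/2) ((t0+t)/2) < t := max_lt (by linarith) (by linarith [ht.1])
  refine ⟨max (t - δ/2) ((t0+t)/2), ⟨lt_max_of_lt_right (by linarith [ht.1]), hm⟩, ?_⟩
  intro τ hτ
  have a1 := (le_max_left _ _).trans hτ.1
  have a2 := (le_max_right _ _).trans hτ.1
  refine h1 ?_ ⟨by linarith [ht.1], hτ.2.trans ht.2⟩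
  rw [Real.dist_eq, abs_lt]
  constructor <;> linarith [hτ.2]

theorem R1_fact1 {u : ℝ → ℝ → ℝ} {κ M y y' t0 t1 x0 : ℝ} (h : PS u κ M y y' t0 t1) (hκ : 0 ≤ κ)
    (hM : 0 ≤ M) (hy : y ≤ y')
    (hl1 : ∀ τ ∈ Icc t0 t1, u y τ < 0) (hl2 : ∀ τ ∈ Icc t0 t1, 0 < u y' τ)
    (hb1 : ∀ x ∈ Icc y y', x < x0 → u x t0 < 0) (hb2 : ∀ x ∈ Icc y y', x0 < x → 0 < u x t0) :
    ∀ t ∈ Icc t0 t1, ∀ a ∈ Icc y y', ∀ b ∈ Icc y y', a ≤ b → 0 < u a t → u b t < 0 → False := by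
  intro t ht a ha b hb hab hua hub
  obtain ⟨μ1, hμ1, c1⟩ := side_bound (h.cont_t ⟨le_rfl, hy⟩) (Or.inr fun τ hτ => (hl1 τ hτ).ne)
  obtain ⟨μ2, hμ2, c2⟩ := side_bound (h.cont_t ⟨hy, le_rfl⟩) (Or.inr fun τ hτ => (hl2 τ hτ).ne')
  set L := min (min (u a t) (- u b t)) (min μ1 μ2) with hL
  have hLp : 0 < L := lt_min (lt_min hua (by linarith)) (lt_min hμ1 hμ2)
  have L1 : L ≤ u a t := (min_le_left _ _).trans (min_le_left _ _)
  have L2 : L ≤ - u b t := (min_le_left _ _).trans (min_le_right _ _)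
  have L3 : L ≤ μ1 := (min_le_right _ _).trans (min_le_left _ _)
  have L4 : L ≤ μ2 := (min_le_right _ _).trans (min_le_right _ _)
  have h' : PS u κ M y y' t0 t := h.mono le_rfl le_rfl le_rfl ht.2
  have hlamd : ∀ τ, HasDerivAt (fun τ => L * Real.exp ((M+1)*(τ - t)))
      (L * (Real.exp ((M+1)*(τ - t)) * (M+1))) τ := by
    intro τ
    have h0 : HasDerivAt (fun τ => (M+1)*(τ - t)) (M+1) τ := by
      simpa using ((hasDerivAt_id τ).sub_const t).const_mul (M+1)
    exact h0.exp.const_mul L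
  have := alt_lemma 1 u (fun τ => L * Real.exp ((M+1)*(τ - t)))
    y y' t0 t ht.1 h'.1 (by fun_prop) (fun τ => by positivity) ?_ ?_ ?_
  · obtain ⟨q, hq, hq'⟩ := this
    have q0 := hq' 0
    have q1 := hq' 1
    have hp : 0 < L * Real.exp ((M+1)*(t0 - t)) := by positivity
    have e0 : L * Real.exp ((M+1)*(t0 - t)) ≤ u (q 0) t0 := by simpa using q0.2
    have e1 : L * Real.exp ((M+1)*(t0 - t)) ≤ - u (q 1) t0 := by simpa using q1.2
    have hle : q 0 ≤ q 1 := hq (by simp)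
    have g0 : x0 ≤ q 0 := by
      by_contra hc
      push Not at hc
      linarith [hb1 _ q0.1 hc]
    have g1 : q 1 ≤ x0 := by
      by_contra hc
      push Not at hc
      linarith [hb2 _ q1.1 hc]
    have g2 : q 0 = q 1 := le_antisymm hle (g1.trans g0)
    rw [g2] at e0
    linarith
  · intro X hX i τ hτ hle τ' hτ'
    have hσ : (-1:ℝ)^(i:ℕ) = 1 ∨ (-1:ℝ)^(i:ℕ) = -1 := neg_one_pow_eq_or ℝ _
    have i1 : τ ∈ Icc t0 t1 := ⟨hτ.1, hτ.2.trans ht.2⟩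
    have i2 : τ' ∈ Icc t0 t1 := ⟨hτ'.1, hτ'.2.trans i1.2⟩
    have hp : 0 < L * Real.exp ((M+1)*(τ - t)) := by positivity
    have hlam : L * Real.exp ((M+1)*(τ' - t)) ≤ L := by
      refine mul_le_of_le_one_right hLp.le (Real.exp_le_one_iff.2 ?_)
      exact mul_nonpos_of_nonneg_of_nonpos (by linarith) (by linarith [hτ'.2, hτ.2])
    rcases hX with rfl | rfl
    · exact (hlam.trans L3).trans (c1 _ hσ τ i1 (hp.trans_le hle) τ' i2)
    · exact (hlam.trans L4).trans (c2 _ hσ τ i1 (hp.trans_le hle) τ' i2)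
  · intro i x hx τ hτ hmax heq
    set σ := (-1:ℝ)^(i:ℕ) with hσ
    obtain ⟨ut, a, b, c, e1, e2, e3, e4, e5, e6⟩ := (h'.smul σ).localMax hκ hx ⟨hτ.1.le, hτ.2⟩
      (g := fun _ => 0) (g1 := fun _ => 0) (g2 := 0) (fun y => hasDerivAt_const _ _)
      (hasDerivAt_const _ _) (by simpa using hmax)
    refine ⟨ut - L * (Real.exp ((M+1)*(τ - t)) * (M+1)), e1.sub (hlamd τ), ?_⟩
    rw [heq] at e6
    have hp : 0 < L * Real.exp ((M+1)*(τ - t)) := by positivity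
    have k4 : c * (L * Real.exp ((M+1)*(τ - t))) ≤ M * (L * Real.exp ((M+1)*(τ - t))) :=
      mul_le_mul_of_nonneg_right (le_abs_self c |>.trans e5) hp.le
    linarith
  · refine ⟨![a, b], ?_, ?_⟩
    · rw [Fin.monotone_iff_le_succ]
      intro i
      fin_cases i
      simpa using hab
    · intro i
      fin_cases i
      · simpa using ⟨ha, L1⟩
      · simpa using ⟨hb, L2⟩

theorem R1_fact2 {u : ℝ → ℝ → ℝ} {κ M y y' t0 t1 : ℝ} (h : PS u κ M y y' t0 t1) (hκ : 0 < κ)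
    (hM : 0 ≤ M)
    (hl1 : ∀ τ ∈ Icc t0 t1, u y τ < 0)
    (hf : ∀ t ∈ Icc t0 t1, ∀ a ∈ Icc y y', ∀ b ∈ Icc y y', a ≤ b → 0 < u a t → u b t < 0 → False) :
    ∀ t ∈ Ioc t0 t1, ∀ z ∈ Icc y y', ∀ z' ∈ Icc y y', z ≤ z' → u z t = 0 → 0 ≤ u z' t := by
  intro t ht z hz z' hz' hzz hu0
  by_contra hcon
  push Not at hcon
  have hlt : z < z' := lt_of_le_of_ne hzz (by rintro rfl; linarith)
  have hty : y < z := lt_of_le_of_ne hz.1 (by rintro rfl; linarith [hl1 t ⟨ht.1.le, ht.2⟩])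
  obtain ⟨s, hs, hs'⟩ := left_neg (h.cont_t hz') ht hcon
  have hsub : ∀ τ ∈ Icc s t, τ ∈ Icc t0 t1 := fun τ hτ => ⟨hs.1.le.trans hτ.1, hτ.2.trans ht.2⟩
  have h' := (h.mono (Y1 := y) (Y2 := z') (s1 := s) (t1 := t) le_rfl hz'.2 hs.1.le ht.2).neg
  have := h'.pos hκ hM hs.2 (by
    intro x hx
    by_contra hc
    push Not at hc
    exact hf s (hsub s ⟨le_rfl, hs.2.le⟩) x ⟨hx.1, hx.2.trans hz'.2⟩ z' hz' hx.2 (by linarith)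
      (hs' s ⟨le_rfl, hs.2.le⟩))
    (fun τ hτ => by linarith [hl1 τ (hsub τ hτ)]) (fun τ hτ => by linarith [hs' τ hτ])
    (Or.inl fun τ hτ => by linarith [hl1 τ (hsub τ hτ)]) z ⟨hty, hlt⟩ t ⟨hs.2, le_rfl⟩
  linarith

theorem R1_fact2' {u : ℝ → ℝ → ℝ} {κ M y y' t0 t1 : ℝ} (h : PS u κ M y y' t0 t1) (hκ : 0 < κ)
    (hM : 0 ≤ M)
    (hl2 : ∀ τ ∈ Icc t0 t1, 0 < u y' τ)
    (hf : ∀ t ∈ Icc t0 t1, ∀ a ∈ Icc y y', ∀ b ∈ Icc y y', a ≤ b → 0 < u a t → u b t < 0 → False) :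
    ∀ t ∈ Ioc t0 t1, ∀ z ∈ Icc y y', ∀ z' ∈ Icc y y', z' ≤ z → u z t = 0 → u z' t ≤ 0 := by
  intro t ht z hz z' hz' hzz hu0
  by_contra hcon
  push Not at hcon
  have hlt : z' < z := lt_of_le_of_ne hzz (by rintro rfl; linarith)
  have hty : z < y' := lt_of_le_of_ne hz.2 (by rintro rfl; linarith [hl2 t ⟨ht.1.le, ht.2⟩])
  obtain ⟨s, hs, hs'⟩ := left_neg (f := fun τ => - u z' τ) (h.cont_t hz').neg ht (by linarith)
  have hsub : ∀ τ ∈ Icc s t, τ ∈ Icc t0 t1 := fun τ hτ => ⟨hs.1.le.trans hτ.1, hτ.2.trans ht.2⟩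
  have h' := (h.mono (Y1 := z') (Y2 := y') (s1 := s) (t1 := t) hz'.1 le_rfl hs.1.le ht.2)
  have := h'.pos hκ hM hs.2 (by
    intro x hx
    by_contra hc
    push Not at hc
    exact hf s (hsub s ⟨le_rfl, hs.2.le⟩) z' hz' x ⟨hz'.1.trans hx.1, hx.2⟩ hx.1
      (by linarith [hs' s ⟨le_rfl, hs.2.le⟩]) hc)
    (fun τ hτ => by linarith [hs' τ hτ]) (fun τ hτ => by linarith [hl2 τ (hsub τ hτ)])
    (Or.inr fun τ hτ => by linarith [hl2 τ (hsub τ hτ)]) z ⟨hlt, hty⟩ t ⟨hs.2, le_rfl⟩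
  linarith

theorem R1_aux {u : ℝ → ℝ → ℝ} {κ M y y' t0 t1 x0 : ℝ} (h : PS u κ M y y' t0 t1) (hκ : 0 < κ)
    (hM : 0 ≤ M) (hy : y ≤ y')
    (hl1 : ∀ τ ∈ Icc t0 t1, u y τ < 0) (hl2 : ∀ τ ∈ Icc t0 t1, 0 < u y' τ)
    (hb1 : ∀ x ∈ Icc y y', x < x0 → u x t0 < 0) (hb2 : ∀ x ∈ Icc y y', x0 < x → 0 < u x t0) :
    ∀ t ∈ Ioc t0 t1, ∀ z1 ∈ Icc y y', ∀ z2 ∈ Icc y y', z1 < z2 → u z1 t = 0 → u z2 t = 0 →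
      False := by
  intro t ht z1 hz1 z2 hz2 hlt h1 h2
  have f1 := R1_fact1 h hκ.le hM hy hl1 hl2 hb1 hb2
  have f2 := R1_fact2 h hκ hM hl1 f1
  have f2' := R1_fact2' h hκ hM hl2 f1
  have hzero : ∀ x ∈ Icc z1 z2, u x t = 0 := by
    intro x hx
    have hxI : x ∈ Icc y y' := ⟨hz1.1.trans hx.1, hx.2.trans hz2.2⟩
    exact le_antisymm (f2' t ht z2 hz2 x hxI hx.2 h2) (f2 t ht z1 hz1 x hxI hx.1 h1)
  set r := (z1 + z2)/2 with hr
  have hr1 : z1 < r := by linarith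
  have hr2 : r < z2 := by linarith
  have hrI : r ∈ Icc y y' := ⟨by linarith [hz1.1], by linarith [hz2.2]⟩
  have hz2lt : z2 < y' := lt_of_le_of_ne hz2.2 (by rintro rfl; linarith [hl2 t ⟨ht.1.le, ht.2⟩])
  have f3 : ∀ η > 0, ∃ s ∈ Ioo (t - η) t, (t0 + t)/2 ≤ s ∧ ∀ x ∈ Icc y r, u x s < 0 := by
    intro η hη
    by_contra hcon
    push Not at hcon
    set s0 := max (t - η/2) ((t0+t)/2) with hs0
    have hs0t : s0 < t := max_lt (by linarith) (by linarith [ht.1])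
    have hs01 : t - η/2 ≤ s0 := le_max_left _ _
    have hs02 : (t0+t)/2 ≤ s0 := le_max_right _ _
    have hnn : ∀ s ∈ Icc s0 t, ∀ b ∈ Icc r y', 0 ≤ u b s := by
      intro s hs b hb
      have hbI : b ∈ Icc y y' := ⟨hrI.1.trans hb.1, hb.2⟩
      have hsI : s ∈ Ioc t0 t1 := ⟨by linarith [hs.1, ht.1], hs.2.trans ht.2⟩
      rcases eq_or_lt_of_le hs.2 with rfl | hst
      · exact f2 s hsI z1 hz1 b hbI (by linarith [hb.1]) h1
      · obtain ⟨x, hx, hux⟩ := hcon s ⟨by linarith [hs.1], hst⟩ (by linarith [hs.1])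
        have hxI : x ∈ Icc y y' := ⟨hx.1, hx.2.trans hrI.2⟩
        rcases eq_or_lt_of_le hux with hux | hux
        · exact f2 s hsI x hxI b hbI (hx.2.trans hb.1) hux.symm
        · by_contra hc
          push Not at hc
          exact f1 s ⟨hsI.1.le, hsI.2⟩ x hxI b hbI (hx.2.trans hb.1) hux hc
    have h' := (h.mono (Y1 := r) (Y2 := y') (s1 := s0) (t1 := t) hrI.1 le_rfl
      (by linarith [ht.1]) ht.2)
    have := h'.pos hκ hM hs0t (fun x hx => hnn s0 ⟨le_rfl, hs0t.le⟩ x hx)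
      (fun τ hτ => hnn τ hτ r ⟨le_rfl, hrI.2⟩) (fun τ hτ => hnn τ hτ y' ⟨hrI.2, le_rfl⟩)
      (Or.inr fun τ hτ => hl2 τ ⟨by linarith [hτ.1, ht.1], hτ.2.trans ht.2⟩) z2 ⟨hr2, hz2lt⟩ t
      ⟨hs0t, le_rfl⟩
    linarith
  have hT : ∀ τ ∈ Icc ((t0+t)/2) t, τ ∈ Icc t0 t1 := fun τ hτ =>
    ⟨by linarith [hτ.1, ht.1], hτ.2.trans ht.2⟩
  refine key (h.mono (Y1 := y) (Y2 := y') (s1 := (t0+t)/2) (t1 := t) le_rfl le_rfl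
    (by linarith [ht.1]) ht.2) hκ.le hM (Or.inr fun τ hτ => (hl1 τ (hT τ hτ)).ne)
    (Or.inr fun τ hτ => (hl2 τ (hT τ hτ)).ne') hy hz1.1 (hr2.le.trans hz2.2) (β := r)
    (fun x hx => hzero x ⟨hx.1, hx.2.trans hr2.le⟩) 1 ((r - z1)/2) (by linarith) ?_
  intro η hη
  obtain ⟨s, hs, hsτ, hneg⟩ := f3 η hη
  have hsI : s ∈ Ioc t0 t1 := ⟨by linarith [ht.1], hs.2.le.trans ht.2⟩
  refine ⟨s, hs, hsτ, (z1 + r)/2, by linarith, by linarith, ?_, ?_⟩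
  · intro x hx
    exact (hneg x ⟨by linarith [hx.1, hz1.1], by linarith [hx.2]⟩).ne
  · have hc : ContinuousOn (fun x => u x s) (Icc y y') := h.cont_x ⟨hsI.1.le, hsI.2⟩
    obtain ⟨z, hz, hz0⟩ := intermediate_value_Icc hy hc
      ⟨(hl1 s ⟨hsI.1.le, hsI.2⟩).le, (hl2 s ⟨hsI.1.le, hsI.2⟩).le⟩
    simp only at hz0
    refine ⟨{z}, ?_, by simp, 1, Or.inl rfl, ?_⟩
    · intro w hw
      rw [Finset.mem_singleton] at hw
      exact hw ▸ ⟨hz, hz0⟩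
    · intro x hx
      rw [Finset.prod_singleton, one_mul]
      rcases le_total x z with hxz | hxz
      · exact mul_nonneg_of_nonpos_of_nonpos (by linarith) (f2' s hsI z hz x hx hxz hz0)
      · exact mul_nonneg (by linarith) (f2 s hsI z hz x hx hxz hz0)

theorem R1 {u : ℝ → ℝ → ℝ} {κ M y y' t0 t1 x0 : ℝ} (h : PS u κ M y y' t0 t1) (hκ : 0 < κ)
    (hM : 0 ≤ M) (hy : y ≤ y')
    (hl1 : ∀ τ ∈ Icc t0 t1, u y τ < 0) (hl2 : ∀ τ ∈ Icc t0 t1, 0 < u y' τ)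
    (hb1 : ∀ x ∈ Icc y y', x < x0 → u x t0 < 0) (hb2 : ∀ x ∈ Icc y y', x0 < x → 0 < u x t0) :
    ∀ t ∈ Ioc t0 t1, ∀ z1 ∈ Icc y y', ∀ z2 ∈ Icc y y', u z1 t = 0 → u z2 t = 0 → z1 = z2 := by
  intro t ht z1 hz1 z2 hz2 h1 h2
  have := R1_aux h hκ hM hy hl1 hl2 hb1 hb2 t ht
  rcases lt_trichotomy z1 z2 with hlt | heq | hlt
  · exact (this z1 hz1 z2 hz2 hlt h1 h2).elim
  · exact heq
  · exact (this z2 hz2 z1 hz1 hlt h2 h1).elim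


theorem right_pos {f : ℝ → ℝ} {t0 t1 : ℝ} (hf : ContinuousOn f (Icc t0 t1)) (ht : t0 < t1)
    (h : 0 < f t0) : ∃ t' ∈ Ioc t0 t1, ∀ τ ∈ Icc t0 t', 0 < f τ := by
  have hc : ContinuousWithinAt f (Icc t0 t1) t0 := hf t0 ⟨le_rfl, ht.le⟩
  have h1 : ∀ᶠ τ in 𝓝[Icc t0 t1] t0, 0 < f τ := hc.eventually (lt_mem_nhds h)
  rw [eventually_nhdsWithin_iff, Metric.eventually_nhds_iff] at h1
  obtain ⟨δ, hδ, h1⟩ := h1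
  refine ⟨min (t0 + δ/2) t1, ⟨lt_min (by linarith) ht, min_le_right _ _⟩, ?_⟩
  intro τ hτ
  have a1 := hτ.2.trans (min_le_left _ _)
  have a2 := hτ.2.trans (min_le_right _ _)
  refine h1 ?_ ⟨hτ.1, a2⟩
  rw [Real.dist_eq, abs_lt]
  constructor <;> linarith [hτ.1]

theorem Rint {u : ℝ → ℝ → ℝ} {κ M y y' t0 t1 x0 : ℝ} (h : PS u κ M y y' t0 t1) (hκ : 0 < κ)
    (hM : 0 ≤ M) (hlt : t0 < t1) (hy : y < x0) (hy' : x0 < y') (h0 : u x0 t0 = 0)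
    (hne : ∀ x ∈ Icc y y', x ≠ x0 → u x t0 ≠ 0) (hpos : 0 < u y' t0) :
    ∃ t' ∈ Ioc t0 t1, ∀ t ∈ Ioc t0 t', ∀ z1 ∈ Ioo y y', ∀ z2 ∈ Ioo y y',
      u z1 t = 0 → u z2 t = 0 → z1 = z2 := by
  have hyy : y ≤ y' := (hy.trans hy').le
  have hc : ContinuousOn (fun x => u x t0) (Icc y y') := h.cont_x ⟨le_rfl, hlt.le⟩
  have hR : ∀ x ∈ Icc y y', x0 < x → 0 < u x t0 := by
    rcases const_sign (show (Ioc x0 y').OrdConnected from ordConnected_Ioc)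
      (hc.mono fun x hx => ⟨(hy.trans hx.1).le, hx.2⟩)
      (fun x hx => hne x ⟨(hy.trans hx.1).le, hx.2⟩ hx.1.ne') with hs | hs
    · exact fun x hx hx0 => hs x ⟨hx0, hx.2⟩
    · exact absurd (hs y' ⟨hy', le_rfl⟩) (not_lt.2 hpos.le)
  obtain ⟨ta, hta, hta'⟩ := right_pos (h.cont_t ⟨hyy, le_rfl⟩) hlt hpos
  rcases const_sign (show (Ico y x0).OrdConnected from ordConnected_Ico)
      (hc.mono fun x hx => ⟨hx.1, (hx.2.trans hy').le⟩)
      (fun x hx => hne x ⟨hx.1, (hx.2.trans hy').le⟩ hx.2.ne) with hs | hs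
  · obtain ⟨tb, htb, htb'⟩ := right_pos (h.cont_t ⟨le_rfl, hyy⟩) hlt (hs y ⟨le_rfl, hy⟩)
    have hm : min ta tb ∈ Ioc t0 t1 := ⟨lt_min hta.1 htb.1, (min_le_left _ _).trans hta.2⟩
    refine ⟨min ta tb, hm, ?_⟩
    intro t ht z1 hz1 z2 hz2 e1
    have := (h.mono (Y1 := y) (Y2 := y') (s1 := t0) (t1 := min ta tb) le_rfl le_rfl le_rfl hm.2).pos
      hκ hM hm.1 (by
        intro x hx
        rcases lt_trichotomy x x0 with hx0 | hx0 | hx0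
        · exact (hs x ⟨hx.1, hx0⟩).le
        · rw [hx0, h0]
        · exact (hR x hx hx0).le)
      (fun τ hτ => (htb' τ ⟨hτ.1, hτ.2.trans (min_le_right _ _)⟩).le)
      (fun τ hτ => (hta' τ ⟨hτ.1, hτ.2.trans (min_le_left _ _)⟩).le)
      (Or.inl fun τ hτ => (htb' τ ⟨hτ.1, hτ.2.trans (min_le_right _ _)⟩)) z1 hz1 t ht
    linarith
  · obtain ⟨tb, htb, htb'⟩ := right_pos (f := fun τ => - u y τ) (h.cont_t ⟨le_rfl, hyy⟩).neg hlt
      (by linarith [hs y ⟨le_rfl, hy⟩])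
    have hm : min ta tb ∈ Ioc t0 t1 := ⟨lt_min hta.1 htb.1, (min_le_left _ _).trans hta.2⟩
    refine ⟨min ta tb, hm, ?_⟩
    intro t ht z1 hz1 z2 hz2 e1 e2
    exact R1 (h.mono (Y1 := y) (Y2 := y') (s1 := t0) (t1 := min ta tb) le_rfl le_rfl le_rfl hm.2)
      hκ hM hyy (fun τ hτ => by linarith [htb' τ ⟨hτ.1, hτ.2.trans (min_le_right _ _)⟩])
      (fun τ hτ => (hta' τ ⟨hτ.1, hτ.2.trans (min_le_left _ _)⟩))
      (x0 := x0) (fun x hx hx0 => hs x ⟨hx.1, hx0⟩) hR t ht z1 ⟨hz1.1.le, hz1.2.le⟩ z2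
      ⟨hz2.1.le, hz2.2.le⟩ e1 e2

theorem Rleft {u : ℝ → ℝ → ℝ} {κ M y y' t0 t1 : ℝ} (h : PS u κ M y y' t0 t1) (hκ : 0 < κ)
    (hM : 0 ≤ M) (hlt : t0 < t1) (hy : y < y') (h0 : ∀ τ ∈ Icc t0 t1, u y τ = 0)
    (hne : ∀ x ∈ Icc y y', x ≠ y → u x t0 ≠ 0) (hpos : 0 < u y' t0) :
    ∃ t' ∈ Ioc t0 t1, ∀ t ∈ Ioc t0 t', ∀ z ∈ Ioo y y', u z t ≠ 0 := by
  have hc : ContinuousOn (fun x => u x t0) (Icc y y') := h.cont_x ⟨le_rfl, hlt.le⟩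
  have hR : ∀ x ∈ Ioc y y', 0 < u x t0 := by
    rcases const_sign (show (Ioc y y').OrdConnected from ordConnected_Ioc)
      (hc.mono fun x hx => ⟨hx.1.le, hx.2⟩)
      (fun x hx => hne x ⟨hx.1.le, hx.2⟩ hx.1.ne') with hs | hs
    · exact hs
    · exact absurd (hs y' ⟨hy, le_rfl⟩) (not_lt.2 hpos.le)
  obtain ⟨ta, hta, hta'⟩ := right_pos (h.cont_t ⟨hy.le, le_rfl⟩) hlt hpos
  refine ⟨ta, hta, fun t ht z hz => ?_⟩
  refine ((h.mono (Y1 := y) (Y2 := y') (s1 := t0) (t1 := ta) le_rfl le_rfl le_rfl hta.2).pos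
      hκ hM hta.1 ?_ (fun τ hτ => (h0 τ ⟨hτ.1, hτ.2.trans hta.2⟩).ge) (fun τ hτ => (hta' τ hτ).le)
      (Or.inr hta') z hz t ht).ne'
  intro x hx
  rcases eq_or_lt_of_le hx.1 with rfl | hx0
  · exact (h0 t0 ⟨le_rfl, hlt.le⟩).ge
  · exact (hR x ⟨hx0, hx.2⟩).le

theorem Rright {u : ℝ → ℝ → ℝ} {κ M y y' t0 t1 : ℝ} (h : PS u κ M y y' t0 t1) (hκ : 0 < κ)
    (hM : 0 ≤ M) (hlt : t0 < t1) (hy : y < y') (h0 : ∀ τ ∈ Icc t0 t1, u y' τ = 0)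
    (hne : ∀ x ∈ Icc y y', x ≠ y' → u x t0 ≠ 0) (hpos : 0 < u y t0) :
    ∃ t' ∈ Ioc t0 t1, ∀ t ∈ Ioc t0 t', ∀ z ∈ Ioo y y', u z t ≠ 0 := by
  have hc : ContinuousOn (fun x => u x t0) (Icc y y') := h.cont_x ⟨le_rfl, hlt.le⟩
  have hR : ∀ x ∈ Ico y y', 0 < u x t0 := by
    rcases const_sign (show (Ico y y').OrdConnected from ordConnected_Ico)
      (hc.mono fun x hx => ⟨hx.1, hx.2.le⟩)
      (fun x hx => hne x ⟨hx.1, hx.2.le⟩ hx.2.ne) with hs | hs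
    · exact hs
    · exact absurd (hs y ⟨le_rfl, hy⟩) (not_lt.2 hpos.le)
  obtain ⟨ta, hta, hta'⟩ := right_pos (h.cont_t ⟨le_rfl, hy.le⟩) hlt hpos
  refine ⟨ta, hta, fun t ht z hz => ?_⟩
  refine ((h.mono (Y1 := y) (Y2 := y') (s1 := t0) (t1 := ta) le_rfl le_rfl le_rfl hta.2).pos
      hκ hM hta.1 ?_ (fun τ hτ => (hta' τ hτ).le) (fun τ hτ => (h0 τ ⟨hτ.1, hτ.2.trans hta.2⟩).ge)
      (Or.inl hta') z hz t ht).ne'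
  intro x hx
  rcases eq_or_lt_of_le hx.2 with rfl | hx0
  · exact (h0 t0 ⟨le_rfl, hlt.le⟩).ge
  · exact (hR x ⟨hx.1, hx0⟩).le

theorem Rloc {u : ℝ → ℝ → ℝ} {κ M X1 X2 t0 t1 : ℝ} (h : PS u κ M X1 X2 t0 t1) (hκ : 0 < κ)
    (hM : 0 ≤ M) (hlt : t0 < t1) (hX : X1 < X2)
    (hl1 : (∀ τ ∈ Icc t0 t1, u X1 τ = 0) ∨ (∀ τ ∈ Icc t0 t1, u X1 τ ≠ 0))
    (hl2 : (∀ τ ∈ Icc t0 t1, u X2 τ = 0) ∨ (∀ τ ∈ Icc t0 t1, u X2 τ ≠ 0))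
    (x0 : ℝ) (hx0 : x0 ∈ Icc X1 X2) (ρ : ℝ) (hρ : 0 < ρ)
    (hiso : ∀ x ∈ Icc X1 X2, |x - x0| < ρ → x ≠ x0 → u x t0 ≠ 0) :
    ∃ U : Set ℝ, IsOpen U ∧ x0 ∈ U ∧ ∃ t' ∈ Ioc t0 t1, ∀ t ∈ Ioc t0 t',
      (∀ z1 ∈ Icc X1 X2 ∩ U, ∀ z2 ∈ Icc X1 X2 ∩ U, u z1 t = 0 → u z2 t = 0 → z1 = z2) ∧
      (u x0 t0 ≠ 0 → ∀ z ∈ Icc X1 X2 ∩ U, u z t ≠ 0) := by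
  have ht0 : t0 ∈ Icc t0 t1 := ⟨le_rfl, hlt.le⟩
  by_cases h0 : u x0 t0 = 0
  · suffices hsuf : ∃ U : Set ℝ, IsOpen U ∧ x0 ∈ U ∧ ∃ t' ∈ Ioc t0 t1, ∀ t ∈ Ioc t0 t',
      (∀ z1 ∈ Icc X1 X2 ∩ U, ∀ z2 ∈ Icc X1 X2 ∩ U, u z1 t = 0 → u z2 t = 0 → z1 = z2) by
      obtain ⟨U, hU, hxU, t', ht', hh⟩ := hsuf
      exact ⟨U, hU, hxU, t', ht', fun t ht => ⟨hh t ht, fun hn => absurd h0 hn⟩⟩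
    rcases eq_or_lt_of_le hx0.1 with hx1 | hx1
    · subst hx1
      have hz : ∀ τ ∈ Icc t0 t1, u X1 τ = 0 := by
        rcases hl1 with hl | hl
        · exact hl
        · exact absurd h0 (hl t0 ht0)
      set y' := min (X1 + ρ/2) X2 with hy'
      have hyl : X1 < y' := lt_min (by linarith) hX
      have hy2 : y' ≤ X2 := min_le_right _ _
      have hy3 : y' ≤ X1 + ρ/2 := min_le_left _ _
      have hne : ∀ x ∈ Icc X1 y', x ≠ X1 → u x t0 ≠ 0 := fun x hx hxne =>
        hiso x ⟨hx.1, hx.2.trans hy2⟩ (by rw [abs_lt]; constructor <;> linarith [hx.1, hx.2]) hxne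
      have h' := h.mono (Y1 := X1) (Y2 := y') (s1 := t0) (t1 := t1) le_rfl hy2 le_rfl le_rfl
      obtain ⟨t', ht', hh⟩ : ∃ t' ∈ Ioc t0 t1, ∀ t ∈ Ioc t0 t', ∀ z ∈ Ioo X1 y', u z t ≠ 0 := by
        rcases lt_or_gt_of_ne (hne y' ⟨hyl.le, le_rfl⟩ hyl.ne') with hs | hs
        · obtain ⟨t', ht', hh⟩ := Rleft h'.neg hκ hM hlt hyl (fun τ hτ => by simp [hz τ hτ])
            (fun x hx hxne => by simpa using hne x hx hxne) (by linarith)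
          exact ⟨t', ht', fun t ht z hz => by simpa using hh t ht z hz⟩
        · exact Rleft h' hκ hM hlt hyl hz hne hs
      refine ⟨Iio y', isOpen_Iio, hyl, t', ht', fun t ht => ?_⟩
      have : ∀ z ∈ Icc X1 X2 ∩ Iio y', u z t = 0 → z = X1 := by
        intro z hz hz0
        by_contra hne
        exact hh t ht z ⟨lt_of_le_of_ne hz.1.1 (Ne.symm hne), hz.2⟩ hz0
      intro z1 hz1 z2 hz2 e1 e2
      rw [this z1 hz1 e1, this z2 hz2 e2]
    rcases eq_or_lt_of_le hx0.2 with hx2 | hx2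
    · subst hx2
      have hz : ∀ τ ∈ Icc t0 t1, u x0 τ = 0 := by
        rcases hl2 with hl | hl
        · exact hl
        · exact absurd h0 (hl t0 ht0)
      set y' := max (x0 - ρ/2) X1 with hy'
      have hyl : y' < x0 := max_lt (by linarith) hX
      have hy2 : X1 ≤ y' := le_max_right _ _
      have hy3 : x0 - ρ/2 ≤ y' := le_max_left _ _
      have hne : ∀ x ∈ Icc y' x0, x ≠ x0 → u x t0 ≠ 0 := fun x hx hxne =>
        hiso x ⟨hy2.trans hx.1, hx.2⟩ (by rw [abs_lt]; constructor <;> linarith [hx.1, hx.2]) hxne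
      have h' := h.mono (Y1 := y') (Y2 := x0) (s1 := t0) (t1 := t1) hy2 le_rfl le_rfl le_rfl
      obtain ⟨t', ht', hh⟩ : ∃ t' ∈ Ioc t0 t1, ∀ t ∈ Ioc t0 t', ∀ z ∈ Ioo y' x0, u z t ≠ 0 := by
        rcases lt_or_gt_of_ne (hne y' ⟨le_rfl, hyl.le⟩ hyl.ne) with hs | hs
        · obtain ⟨t', ht', hh⟩ := Rright h'.neg hκ hM hlt hyl (fun τ hτ => by simp [hz τ hτ])
            (fun x hx hxne => by simpa using hne x hx hxne) (by linarith)
          exact ⟨t', ht', fun t ht z hz => by simpa using hh t ht z hz⟩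
        · exact Rright h' hκ hM hlt hyl hz hne hs
      refine ⟨Ioi y', isOpen_Ioi, hyl, t', ht', fun t ht => ?_⟩
      have : ∀ z ∈ Icc X1 x0 ∩ Ioi y', u z t = 0 → z = x0 := by
        intro z hz hz0
        by_contra hne
        exact hh t ht z ⟨hz.2, lt_of_le_of_ne hz.1.2 hne⟩ hz0
      intro z1 hz1 z2 hz2 e1 e2
      rw [this z1 hz1 e1, this z2 hz2 e2]
    · set y := max (x0 - ρ/2) X1 with hy
      set y' := min (x0 + ρ/2) X2 with hy'
      have a1 : y < x0 := max_lt (by linarith) hx1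
      have a2 : X1 ≤ y := le_max_right _ _
      have a3 : x0 - ρ/2 ≤ y := le_max_left _ _
      have b1 : x0 < y' := lt_min (by linarith) hx2
      have b2 : y' ≤ X2 := min_le_right _ _
      have b3 : y' ≤ x0 + ρ/2 := min_le_left _ _
      have hne : ∀ x ∈ Icc y y', x ≠ x0 → u x t0 ≠ 0 := fun x hx hxne =>
        hiso x ⟨a2.trans hx.1, hx.2.trans b2⟩
          (by rw [abs_lt]; constructor <;> linarith [hx.1, hx.2]) hxne
      have h' := h.mono (Y1 := y) (Y2 := y') (s1 := t0) (t1 := t1) a2 b2 le_rfl le_rfl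
      obtain ⟨t', ht', hh⟩ : ∃ t' ∈ Ioc t0 t1, ∀ t ∈ Ioc t0 t', ∀ z1 ∈ Ioo y y', ∀ z2 ∈ Ioo y y',
          u z1 t = 0 → u z2 t = 0 → z1 = z2 := by
        rcases lt_or_gt_of_ne (hne y' ⟨(a1.trans b1).le, le_rfl⟩ b1.ne') with hs | hs
        · obtain ⟨t', ht', hh⟩ := Rint h'.neg hκ hM hlt a1 b1 (by simp [h0])
            (fun x hx hxne => by simpa using hne x hx hxne) (by linarith)
          exact ⟨t', ht', fun t ht z1 hz1 z2 hz2 e1 e2 => hh t ht z1 hz1 z2 hz2 (by simpa using e1)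
            (by simpa using e2)⟩
        · exact Rint h' hκ hM hlt a1 b1 h0 hne hs
      refine ⟨Ioo y y', isOpen_Ioo, ⟨a1, b1⟩, t', ht', fun t ht z1 hz1 z2 hz2 e1 e2 => ?_⟩
      exact hh t ht z1 hz1.2 z2 hz2.2 e1 e2
  · have hc : ContinuousWithinAt (fun p : ℝ × ℝ => u p.1 p.2) (Icc X1 X2 ×ˢ Icc t0 t1) (x0, t0) :=
      h.1 (x0, t0) ⟨hx0, ht0⟩
    have h1 := hc.eventually (isOpen_ne.mem_nhds h0)
    rw [eventually_nhdsWithin_iff, Metric.eventually_nhds_iff] at h1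
    obtain ⟨δ, hδ, h1⟩ := h1
    have hm : min (t0 + δ/2) t1 ∈ Ioc t0 t1 := ⟨lt_min (by linarith) hlt, min_le_right _ _⟩
    have hnz : ∀ t ∈ Ioc t0 (min (t0 + δ/2) t1), ∀ z ∈ Icc X1 X2 ∩ Metric.ball x0 δ, u z t ≠ 0 := by
      intro t ht z hz
      have a1 := ht.2.trans (min_le_left _ _)
      have a2 := ht.2.trans (min_le_right _ _)
      refine h1 (y := (z, t)) ?_ ⟨hz.1, ⟨ht.1.le, a2⟩⟩
      rw [Prod.dist_eq, max_lt_iff]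
      refine ⟨hz.2, ?_⟩
      simp only [Real.dist_eq, abs_lt]
      constructor <;> linarith [ht.1]
    refine ⟨Metric.ball x0 δ, Metric.isOpen_ball, Metric.mem_ball_self hδ, _, hm, fun t ht =>
      ⟨fun z1 hz1 z2 hz2 e1 => absurd e1 (hnz t ht z1 hz1), fun _ => hnz t ht⟩⟩

/-- zero set on [X1,X2] at time t -/
def ZS (u : ℝ → ℝ → ℝ) (X1 X2 t : ℝ) : Set ℝ := {x ∈ Icc X1 X2 | u x t = 0}

theorem Rglob {u : ℝ → ℝ → ℝ} {κ M X1 X2 t0 t1 : ℝ} (h : PS u κ M X1 X2 t0 t1) (hκ : 0 < κ)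
    (hM : 0 ≤ M) (hlt : t0 < t1) (hX : X1 < X2)
    (hl1 : (∀ τ ∈ Icc t0 t1, u X1 τ = 0) ∨ (∀ τ ∈ Icc t0 t1, u X1 τ ≠ 0))
    (hl2 : (∀ τ ∈ Icc t0 t1, u X2 τ = 0) ∨ (∀ τ ∈ Icc t0 t1, u X2 τ ≠ 0))
    (hfin : (ZS u X1 X2 t0).Finite) :
    ∃ t' ∈ Ioc t0 t1, ∀ t ∈ Ioc t0 t', (ZS u X1 X2 t).encard ≤ (ZS u X1 X2 t0).encard := by
  have hloc : ∀ x0 ∈ Icc X1 X2, ∃ U : Set ℝ, IsOpen U ∧ x0 ∈ U ∧ ∃ t' ∈ Ioc t0 t1, ∀ t ∈ Ioc t0 t',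
      (∀ z1 ∈ Icc X1 X2 ∩ U, ∀ z2 ∈ Icc X1 X2 ∩ U, u z1 t = 0 → u z2 t = 0 → z1 = z2) ∧
      (u x0 t0 ≠ 0 → ∀ z ∈ Icc X1 X2 ∩ U, u z t ≠ 0) := by
    intro x0 hx0
    have hfin' : (ZS u X1 X2 t0 \ {x0}).Finite := hfin.subset sdiff_subset
    have : (ZS u X1 X2 t0 \ {x0})ᶜ ∈ 𝓝 x0 := hfin'.isClosed.isOpen_compl.mem_nhds (by simp)
    obtain ⟨ρ, hρ, hb⟩ := Metric.mem_nhds_iff.1 this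
    refine Rloc h hκ hM hlt hX hl1 hl2 x0 hx0 ρ hρ fun x hx hxr hne h0 => ?_
    have := hb (show x ∈ Metric.ball x0 ρ from hxr)
    exact this ⟨⟨hx, h0⟩, hne⟩
  choose! U hU hxU t' ht' hh using hloc
  obtain ⟨F, hF, hcov⟩ := isCompact_Icc.elim_nhds_subcover U fun x hx => (hU x hx).mem_nhds (hxU x hx)
  have hFne : F.Nonempty := by
    by_contra hc
    rw [Finset.not_nonempty_iff_eq_empty] at hc
    have := hcov (show X1 ∈ Icc X1 X2 from ⟨le_rfl, hX.le⟩)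
    simp [hc] at this
  refine ⟨F.inf' hFne t', ⟨(Finset.lt_inf'_iff _).2 fun x hx => (ht' x (hF x hx)).1, ?_⟩, ?_⟩
  · obtain ⟨x, hx⟩ := hFne
    exact (Finset.inf'_le _ hx).trans (ht' x (hF x hx)).2
  · intro t ht
    have hx : ∀ z ∈ ZS u X1 X2 t, ∃ x ∈ F, z ∈ U x := by
      intro z hz
      have := hcov hz.1
      simpa using this
    choose! x hxF hzU using hx
    have hti : ∀ z ∈ ZS u X1 X2 t, t ∈ Ioc t0 (t' (x z)) := fun z hz =>
      ⟨ht.1, ht.2.trans (Finset.inf'_le _ (hxF z hz))⟩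
    refine encard_le_encard_of_injOn (f := x) ?_ ?_
    · intro z hz
      have hxI := hF _ (hxF z hz)
      refine ⟨hxI, ?_⟩
      by_contra hne
      exact (hh _ hxI t (hti z hz)).2 hne z ⟨hz.1, hzU z hz⟩ hz.2
    · intro z1 hz1 z2 hz2 he
      have hxI := hF _ (hxF z1 hz1)
      exact (hh _ hxI t (hti z1 hz1)).1 z1 ⟨hz1.1, hzU z1 hz1⟩ z2 ⟨hz2.1, by rw [he]; exact hzU z2 hz2⟩
        hz1.2 hz2.2


theorem Lint {u : ℝ → ℝ → ℝ} {κ M y y' s0 t0 x : ℝ} (h : PS u κ M y y' s0 t0) (hκ : 0 < κ)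
    (hM : 0 ≤ M) (hlt : s0 < t0) (hy : y < x) (hy' : x < y') (h0 : u x t0 = 0)
    (hne : u y t0 ≠ 0) (hpos : 0 < u y' t0) :
    ∃ s' ∈ Ico s0 t0, ∀ s ∈ Ico s' t0, ∃ z ∈ Icc y y', u z s = 0 := by
  have hyy : y ≤ y' := (hy.trans hy').le
  have ht0 : t0 ∈ Ioc s0 t0 := ⟨hlt, le_rfl⟩
  obtain ⟨sa, hsa, hsa'⟩ := left_neg (f := fun τ => - u y' τ) (h.cont_t ⟨hyy, le_rfl⟩).neg ht0
    (by linarith)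
  rcases lt_or_gt_of_ne hne with hs | hs
  · obtain ⟨sb, hsb, hsb'⟩ := left_neg (h.cont_t ⟨le_rfl, hyy⟩) ht0 hs
    refine ⟨max sa sb, ⟨hsa.1.le.trans (le_max_left _ _), max_lt hsa.2 hsb.2⟩, fun s hs => ?_⟩
    have a1 := (le_max_left _ _).trans hs.1
    have a2 := (le_max_right _ _).trans hs.1
    obtain ⟨z, hz, hz0⟩ := intermediate_value_Icc hyy
      (h.cont_x (τ := s) ⟨hsa.1.le.trans a1, hs.2.le⟩)
      ⟨(hsb' s ⟨a2, hs.2.le⟩).le, by linarith [hsa' s ⟨a1, hs.2.le⟩]⟩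
    exact ⟨z, hz, hz0⟩
  · obtain ⟨sb, hsb, hsb'⟩ := left_neg (f := fun τ => - u y τ) (h.cont_t ⟨le_rfl, hyy⟩).neg ht0
      (by linarith)
    refine ⟨max sa sb, ⟨hsa.1.le.trans (le_max_left _ _), max_lt hsa.2 hsb.2⟩, fun s hs => ?_⟩
    have a1 := (le_max_left _ _).trans hs.1
    have a2 := (le_max_right _ _).trans hs.1
    by_contra hcon
    push Not at hcon
    have hu1 : ∀ τ ∈ Icc s t0, 0 < u y τ := fun τ hτ => by linarith [hsb' τ ⟨a2.trans hτ.1, hτ.2⟩]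
    have hu2 : ∀ τ ∈ Icc s t0, 0 < u y' τ := fun τ hτ => by linarith [hsa' τ ⟨a1.trans hτ.1, hτ.2⟩]
    have hbot : ∀ x ∈ Icc y y', 0 ≤ u x s := by
      rcases const_sign ordConnected_Icc
        (h.cont_x (τ := s) ⟨hsa.1.le.trans a1, hs.2.le⟩) hcon with hc | hc
      · exact fun x hx => (hc x hx).le
      · have c1 := hc y ⟨le_rfl, hyy⟩
        have c2 := hu1 s ⟨le_rfl, hs.2.le⟩
        linarith
    have := (h.mono (Y1 := y) (Y2 := y') (s1 := s) (t1 := t0) le_rfl le_rfl (hsa.1.le.trans a1)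
      le_rfl).pos hκ hM hs.2 hbot (fun τ hτ => (hu1 τ hτ).le) (fun τ hτ => (hu2 τ hτ).le)
      (Or.inl hu1) x ⟨hy, hy'⟩ t0 ⟨hs.2, le_rfl⟩
    linarith

theorem Lloc {u : ℝ → ℝ → ℝ} {κ M X1 X2 s0 t0 : ℝ} (h : PS u κ M X1 X2 s0 t0) (hκ : 0 < κ)
    (hM : 0 ≤ M) (hlt : s0 < t0)
    (hl1 : (∀ τ ∈ Icc s0 t0, u X1 τ = 0) ∨ (∀ τ ∈ Icc s0 t0, u X1 τ ≠ 0))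
    (hl2 : (∀ τ ∈ Icc s0 t0, u X2 τ = 0) ∨ (∀ τ ∈ Icc s0 t0, u X2 τ ≠ 0))
    (hno : ∀ α β, X1 ≤ α → α < β → β ≤ X2 → ∃ x ∈ Icc α β, u x t0 ≠ 0)
    (x : ℝ) (hx : x ∈ ZS u X1 X2 t0) (U : Set ℝ) (hU : IsOpen U) (hxU : x ∈ U) :
    ∃ s' ∈ Ico s0 t0, ∀ s ∈ Ico s' t0, ∃ z ∈ ZS u X1 X2 s, z ∈ U := by
  have ht0 : t0 ∈ Icc s0 t0 := ⟨hlt.le, le_rfl⟩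
  obtain ⟨hxI, h0⟩ := hx
  rcases eq_or_lt_of_le hxI.1 with hx1 | hx1
  · subst hx1
    rcases hl1 with hl | hl
    · exact ⟨s0, ⟨le_rfl, hlt⟩, fun s hs => ⟨X1, ⟨hxI, hl s ⟨hs.1, hs.2.le⟩⟩, hxU⟩⟩
    · exact absurd h0 (hl t0 ht0)
  rcases eq_or_lt_of_le hxI.2 with hx2 | hx2
  · subst hx2
    rcases hl2 with hl | hl
    · exact ⟨s0, ⟨le_rfl, hlt⟩, fun s hs => ⟨x, ⟨hxI, hl s ⟨hs.1, hs.2.le⟩⟩, hxU⟩⟩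
    · exact absurd h0 (hl t0 ht0)
  obtain ⟨ε, hε, hb⟩ := Metric.isOpen_iff.1 hU x hxU
  have pick : ∃ y y', X1 ≤ y ∧ x - ε < y ∧ y < x ∧ x < y' ∧ y' ≤ X2 ∧ y' < x + ε ∧
      u y t0 ≠ 0 ∧ u y' t0 ≠ 0 := by
    set p := max (x - ε/2) X1 with hp
    set q := min (x + ε/2) X2 with hq
    have a1 : p < x := max_lt (by linarith) hx1
    have a2 : X1 ≤ p := le_max_right _ _
    have a3 : x - ε/2 ≤ p := le_max_left _ _
    have b1 : x < q := lt_min (by linarith) hx2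
    have b2 : q ≤ X2 := min_le_right _ _
    have b3 : q ≤ x + ε/2 := min_le_left _ _
    obtain ⟨y, hy, hy0⟩ := hno p ((p + x)/2) a2 (by linarith) (by linarith)
    obtain ⟨y', hy', hy0'⟩ := hno ((x+q)/2) q (by linarith) (by linarith) b2
    exact ⟨y, y', a2.trans hy.1, by linarith [hy.1], by linarith [hy.2], by linarith [hy'.1],
      hy'.2.trans b2, by linarith [hy'.2], hy0, hy0'⟩
  obtain ⟨y, y', p1, p2, p3, p4, p5, p6, p7, p8⟩ := pick
  have h' := h.mono (Y1 := y) (Y2 := y') (s1 := s0) (t1 := t0) p1 p5 le_rfl le_rfl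
  obtain ⟨s', hs', hh⟩ : ∃ s' ∈ Ico s0 t0, ∀ s ∈ Ico s' t0, ∃ z ∈ Icc y y', u z s = 0 := by
    rcases lt_or_gt_of_ne p8 with hs | hs
    · obtain ⟨s', hs', hh⟩ := Lint h'.neg hκ hM hlt p3 p4 (by simp [h0]) (by simpa using p7)
        (by linarith)
      exact ⟨s', hs', fun s hs => by simpa using hh s hs⟩
    · exact Lint h' hκ hM hlt p3 p4 h0 p7 hs
  refine ⟨s', hs', fun s hs => ?_⟩
  obtain ⟨z, hz, hz0⟩ := hh s hs
  refine ⟨z, ⟨⟨p1.trans hz.1, hz.2.trans p5⟩, hz0⟩, hb ?_⟩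
  rw [Metric.mem_ball, Real.dist_eq, abs_lt]
  constructor <;> linarith [hz.1, hz.2]

theorem Lglob {u : ℝ → ℝ → ℝ} {κ M X1 X2 s0 t0 : ℝ} (h : PS u κ M X1 X2 s0 t0) (hκ : 0 < κ)
    (hM : 0 ≤ M) (hlt : s0 < t0) (hX : X1 < X2)
    (hl1 : (∀ τ ∈ Icc s0 t0, u X1 τ = 0) ∨ (∀ τ ∈ Icc s0 t0, u X1 τ ≠ 0))
    (hl2 : (∀ τ ∈ Icc s0 t0, u X2 τ = 0) ∨ (∀ τ ∈ Icc s0 t0, u X2 τ ≠ 0))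
    (n : ℕ) (hn : ∀ s ∈ Ico s0 t0, (ZS u X1 X2 s).encard ≤ n) :
    (ZS u X1 X2 t0).encard ≤ n := by
  by_cases hno : ∀ α β, X1 ≤ α → α < β → β ≤ X2 → ∃ x ∈ Icc α β, u x t0 ≠ 0
  · by_contra hcon
    push Not at hcon
    have hcon' : ((n + 1 : ℕ) : ℕ∞) ≤ (ZS u X1 X2 t0).encard := by
      have := Order.add_one_le_of_lt hcon
      exact_mod_cast this
    obtain ⟨F, hF, hFc⟩ := exists_subset_encard_eq hcon'
    have hFfin : F.Finite := finite_of_encard_eq_coe hFc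
    obtain ⟨U, hU, hUd⟩ := hFfin.t2_separation
    have hloc : ∀ x ∈ F, ∃ s' ∈ Ico s0 t0, ∀ s ∈ Ico s' t0, ∃ z ∈ ZS u X1 X2 s, z ∈ U x :=
      fun x hx => Lloc h hκ hM hlt hl1 hl2 hno x (hF hx) (U x) (hU x).2 (hU x).1
    choose! s' hs' hh using hloc
    have hFne : hFfin.toFinset.Nonempty := by
      rw [Set.Finite.toFinset_nonempty, ← Set.encard_ne_zero, hFc]
      simp
    set s := hFfin.toFinset.sup' hFne s' with hs
    have hst : s < t0 := (Finset.sup'_lt_iff _).2 fun x hx =>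
      (hs' x (hFfin.mem_toFinset.1 hx)).2
    have hsle : ∀ x ∈ F, s' x ≤ s := fun x hx => Finset.le_sup' _ (hFfin.mem_toFinset.2 hx)
    have hs0 : s0 ≤ s := by
      obtain ⟨x, hx⟩ := hFne
      have hx' := hFfin.mem_toFinset.1 hx
      exact (hs' x hx').1.trans (hsle x hx')
    have hz : ∀ x ∈ F, ∃ z ∈ ZS u X1 X2 s, z ∈ U x := fun x hx => hh x hx s ⟨hsle x hx, hst⟩
    choose! z hzZ hzU using hz
    have hle : F.encard ≤ (ZS u X1 X2 s).encard := by
      refine encard_le_encard_of_injOn (f := z) hzZ ?_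
      intro x1 hx1 x2 hx2 he
      by_contra hne
      have := hUd hx1 hx2 hne
      exact Set.disjoint_left.1 this (hzU x1 hx1) (by rw [he]; exact hzU x2 hx2)
    have := hle.trans (hn s ⟨hs0, hst⟩)
    rw [hFc] at this
    have : n + 1 ≤ n := by exact_mod_cast this
    omega
  · exfalso
    push Not at hno
    obtain ⟨α, β, hα, hαβ, hβ, hz⟩ := hno
    set l := (β - α)/(4 * (n+1)) with hl
    have hlp : 0 < l := by
      have : 0 < β - α := by linarith
      positivity
    have hlb : β = α + 4 * (n+1) * l := by rw [hl]; field_simp; ring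
    refine key h hκ.le hM hl1 hl2 hX.le hα hβ hz n l hlp ?_
    intro η hη
    set s := max (t0 - η/2) s0 with hs
    have hst : s < t0 := max_lt (by linarith) hlt
    have hs0 : s0 ≤ s := le_max_right _ _
    have hs1 : t0 - η/2 ≤ s := le_max_left _ _
    have hcard := hn s ⟨hs0, hst⟩
    have hfin : (ZS u X1 X2 s).Finite := finite_of_encard_le_coe hcard
    have hfc : hfin.toFinset.card ≤ n := by
      rw [hfin.encard_eq_coe_toFinset_card] at hcard
      exact_mod_cast hcard
    obtain ⟨S, hS, e, he, hSe⟩ := sq_lemma (fun x => u x s) _ (Icc X1 X2) ordConnected_Icc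
      (h.cont_x ⟨hs0, hst.le⟩) hfin.toFinset (fun x => by rw [hfin.mem_toFinset]; rfl) rfl
    have hcell : ∃ k : Fin (n+1), ∀ x ∈ Icc (α + (4 * (k:ℕ) + 2) * l - l) (α + (4 * (k:ℕ) + 2) * l + l),
        u x s ≠ 0 := by
      by_contra hcon
      push Not at hcon
      choose z hzI hz0 using hcon
      have hkn : ∀ k : Fin (n+1), ((k:ℕ):ℝ) ≤ n := fun k => by
        have : (k:ℕ) ≤ n := by omega
        exact_mod_cast this
      have hmono : StrictMono z := by
        intro i j hij
        have : ((i:ℕ):ℝ) + 1 ≤ ((j:ℕ):ℝ) := by exact_mod_cast hij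
        have h1 := (hzI i).2
        have h2 := (hzI j).1
        nlinarith
      have := Finset.card_le_card_of_injOn (s := Finset.univ) (t := hfin.toFinset) z (by
        intro k _
        refine (hfin.mem_toFinset).2 ⟨⟨?_, ?_⟩, hz0 k⟩
        · have h1 := (hzI k).1
          have : 0 ≤ ((k:ℕ):ℝ) * l := by positivity
          nlinarith
        · have h1 := (hzI k).2
          have : ((k:ℕ):ℝ) * l ≤ n * l := mul_le_mul_of_nonneg_right (hkn k) hlp.le
          nlinarith) hmono.injective.injOn
      simp at this
      omega
    obtain ⟨k, hk⟩ := hcell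
    have hkn : ((k:ℕ):ℝ) ≤ n := by
      have : (k:ℕ) ≤ n := by omega
      exact_mod_cast this
    have k1 : 0 ≤ ((k:ℕ):ℝ) * l := by positivity
    have k2 : ((k:ℕ):ℝ) * l ≤ n * l := mul_le_mul_of_nonneg_right hkn hlp.le
    refine ⟨s, ⟨by linarith, hst⟩, hs0, α + (4 * (k:ℕ) + 2) * l, by nlinarith, by nlinarith, hk, S,
      fun z hz => ?_, (Finset.card_le_card hS).trans hfc, e, he, hSe⟩
    exact hfin.mem_toFinset.1 (hS hz)

theorem mono_glob {u : ℝ → ℝ → ℝ} {κ M X1 X2 t1 t2 : ℝ} (h : PS u κ M X1 X2 t1 t2) (hκ : 0 < κ)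
    (hM : 0 ≤ M) (hlt : t1 ≤ t2) (hX : X1 < X2)
    (hl1 : (∀ τ ∈ Icc t1 t2, u X1 τ = 0) ∨ (∀ τ ∈ Icc t1 t2, u X1 τ ≠ 0))
    (hl2 : (∀ τ ∈ Icc t1 t2, u X2 τ = 0) ∨ (∀ τ ∈ Icc t1 t2, u X2 τ ≠ 0)) :
    (ZS u X1 X2 t2).encard ≤ (ZS u X1 X2 t1).encard := by
  by_cases htop : (ZS u X1 X2 t1).encard = ⊤
  · rw [htop]; exact le_top
  have hfin1 : (ZS u X1 X2 t1).Finite := by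
    rwa [← encard_ne_top_iff]
  set n := hfin1.toFinset.card with hn
  have hen : (ZS u X1 X2 t1).encard = (n : ℕ∞) := hfin1.encard_eq_coe_toFinset_card
  rw [hen]
  have hsub : ∀ {p q : ℝ} {X : ℝ}, t1 ≤ p → q ≤ t2 →
      ((∀ τ ∈ Icc t1 t2, u X τ = 0) ∨ (∀ τ ∈ Icc t1 t2, u X τ ≠ 0)) →
      ((∀ τ ∈ Icc p q, u X τ = 0) ∨ (∀ τ ∈ Icc p q, u X τ ≠ 0)) := by
    intro p q X hp hq hh
    exact hh.imp (fun hh τ hτ => hh τ ⟨hp.trans hτ.1, hτ.2.trans hq⟩)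
      (fun hh τ hτ => hh τ ⟨hp.trans hτ.1, hτ.2.trans hq⟩)
  set B : Set ℝ := {t | t ∈ Icc t1 t2 ∧ ∀ τ ∈ Icc t1 t, (ZS u X1 X2 τ).encard ≤ n} with hB
  have h1B : t1 ∈ B := ⟨⟨le_rfl, hlt⟩, fun τ hτ => by
    rw [le_antisymm hτ.2 hτ.1, hen]⟩
  have hbdd : BddAbove B := ⟨t2, fun t ht => ht.1.2⟩
  set b := sSup B with hb
  have hb1 : t1 ≤ b := le_csSup hbdd h1B
  have hb2 : b ≤ t2 := csSup_le ⟨t1, h1B⟩ fun t ht => ht.1.2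
  have hlow : ∀ τ ∈ Ico t1 b, (ZS u X1 X2 τ).encard ≤ n := by
    intro τ hτ
    obtain ⟨t, htB, hτt⟩ := exists_lt_of_lt_csSup ⟨t1, h1B⟩ hτ.2
    exact htB.2 τ ⟨hτ.1, hτt.le⟩
  have hbn : (ZS u X1 X2 b).encard ≤ n := by
    rcases eq_or_lt_of_le hb1 with he | hl
    · rw [← he, hen]
    · exact Lglob (h.mono le_rfl le_rfl le_rfl hb2) hκ hM hl hX (hsub le_rfl hb2 hl1)
        (hsub le_rfl hb2 hl2) n hlow
  rcases eq_or_lt_of_le hb2 with he | hl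
  · rw [← he]; exact hbn
  · exfalso
    obtain ⟨t', ht', hh⟩ := Rglob (h.mono le_rfl le_rfl hb1 le_rfl) hκ hM hl hX
      (hsub hb1 le_rfl hl1) (hsub hb1 le_rfl hl2) (finite_of_encard_le_coe hbn)
    have : t' ∈ B := by
      refine ⟨⟨hb1.trans ht'.1.le, ht'.2⟩, fun τ hτ => ?_⟩
      rcases lt_trichotomy τ b with hc | hc | hc
      · exact hlow τ ⟨hτ.1, hc⟩
      · rw [hc]; exact hbn
      · exact (hh τ ⟨hc, hτ.2⟩).trans hbn
    have := le_csSup hbdd this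
    linarith [ht'.1]


end Helpers

/-- Theorem A(b): under Dirichlet-type boundary conditions, `Z(t)` is non-increasing
in `t ∈ (0,T)`. -/
theorem zero_number_nonincreasing
    (T xi10 xi20 : ℝ) (a b c u : ℝ → ℝ → ℝ)
    (hT : 0 < T) (hxi : xi10 < xi20)
    (hsol : IsClassicalSolution a b c (fun _ => xi10) (fun _ => xi20) T u)
    (hreg : Reg12 a b c (fun _ => xi10) (fun _ => xi20) T)
    (hbc1 : (∀ t ∈ Icc (0:ℝ) T, u xi10 t = 0) ∨ (∀ t ∈ Icc (0:ℝ) T, u xi10 t ≠ 0))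
    (hbc2 : (∀ t ∈ Icc (0:ℝ) T, u xi20 t = 0) ∨ (∀ t ∈ Icc (0:ℝ) T, u xi20 t ≠ 0)) :
    ∀ t₁ ∈ Ioo (0:ℝ) T, ∀ t₂ ∈ Ioo (0:ℝ) T, t₁ ≤ t₂ →
      Znum u (fun _ => xi10) (fun _ => xi20) t₂ ≤ Znum u (fun _ => xi10) (fun _ => xi20) t₁ := by
  intro t₁ h1 t₂ h2 h12
  obtain ⟨M, hM⟩ := hreg
  have hM0 : (0:ℝ) < max M 1 := lt_of_lt_of_le one_pos (le_max_right _ _)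
  have hps : PS u (max M 1)⁻¹ (max M 1) xi10 xi20 t₁ t₂ := by
    refine ⟨hsol.cont.mono ?_, ?_⟩
    · rintro ⟨x, t⟩ ⟨hx, ht⟩
      exact ⟨⟨h1.1.le.trans ht.1, ht.2.trans h2.2.le⟩, hx⟩
    · intro x hx τ hτ
      have hτ' : τ ∈ Ioc (0:ℝ) T := ⟨h1.1.trans_le hτ.1, hτ.2.trans h2.2.le⟩
      have hd : ∀ y ∈ Icc xi10 xi20,
          ((y, τ) : ℝ × ℝ) ∈ domLat (fun _ => xi10) (fun _ => xi20) T :=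
        fun y hy => ⟨hτ', hy⟩
      have hx' := hd x (Ioo_subset_Icc_self hx)
      obtain ⟨ha, -, -, -, -, -, ha1, ha2, -, -, -, hb, -, -, hc⟩ := hM _ hx'
      refine ⟨pdt u x τ, pdxx u x τ, a x τ, b x τ, c x τ, fun y => pdx u y τ,
        (hsol.diff_t _ hx').hasDerivAt, ?_, (hsol.diff_xx _ hx').hasDerivAt,
        hsol.eqn _ hx', ?_, ?_, hb.trans (le_max_left _ _), hc.trans (le_max_left _ _)⟩
      · filter_upwards [Ioo_mem_nhds hx.1 hx.2] with y hy
        exact (hsol.diff_x _ (hd y (Ioo_subset_Icc_self hy))).hasDerivAt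
      · exact inv_le_of_inv_le₀ ha ((le_abs_self _).trans (ha2.trans (le_max_left _ _)))
      · exact (le_abs_self _).trans (ha1.trans (le_max_left _ _))
  have hsub : ∀ τ ∈ Icc t₁ t₂, τ ∈ Icc (0:ℝ) T :=
    fun τ hτ => ⟨h1.1.le.trans hτ.1, hτ.2.trans h2.2.le⟩
  exact mono_glob hps (inv_pos.mpr hM0) hM0.le h12 hxi
    (hbc1.imp (fun h τ hτ => h τ (hsub τ hτ)) (fun h τ hτ => h τ (hsub τ hτ)))
    (hbc2.imp (fun h τ hτ => h τ (hsub τ hτ)) (fun h τ hτ => h τ (hsub τ hτ)))
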